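/- arXiv:1807.08661 — 4 statements merged into one kernel-verified Lean document; each statement's English description precedes it below -/
import Mathlib

section
/- For each fixed real a < 0 there exist constants C > 0 and δ ∈ (0,1) such that for all b ∈ (0,δ): (1/C)·b^{-1/2} ≤ A₁(a,b) ≤ C·b^{-1/2} and (1/C)·b^{-1/2} ≤ C₁(a,b) ≤ C·b^{-1/2}. (Asymptotic orders of A₁ and C₁ as b → 0⁺.) -/
open MeasureTheory Set

/-- A₁(a,b) = ∫_a^0 (z-a)^{1/2}(-z)^{-3/4}(b-z)^{-3/4}(1-z)^{-3/4} dz -/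
noncomputable def A1 (a b : ℝ) : ℝ :=
  ∫ z in Ioo a 0, (z - a) ^ ((1:ℝ)/2) * (-z) ^ (-(3:ℝ)/4) * (b - z) ^ (-(3:ℝ)/4) * (1 - z) ^ (-(3:ℝ)/4)

/-- B₁(a,b) = ∫_{-∞}^a (a-z)^{1/2}(-z)^{-3/4}(b-z)^{-3/4}(1-z)^{-3/4} dz -/
noncomputable def B1 (a b : ℝ) : ℝ :=
  ∫ z in Iio a, (a - z) ^ ((1:ℝ)/2) * (-z) ^ (-(3:ℝ)/4) * (b - z) ^ (-(3:ℝ)/4) * (1 - z) ^ (-(3:ℝ)/4)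

/-- C₁(a,b) = ∫_b^1 (z-a)^{1/2} z^{-3/4}(z-b)^{-3/4}(1-z)^{-3/4} dz -/
noncomputable def C1 (a b : ℝ) : ℝ :=
  ∫ z in Ioo b 1, (z - a) ^ ((1:ℝ)/2) * z ^ (-(3:ℝ)/4) * (z - b) ^ (-(3:ℝ)/4) * (1 - z) ^ (-(3:ℝ)/4)

/-- A₂(a,b) = ∫_a^0 (z-a)^{-1/2}(-z)^{-1/4}(b-z)^{-1/4}(1-z)^{-1/4} dz -/
noncomputable def A2 (a b : ℝ) : ℝ :=
  ∫ z in Ioo a 0, (z - a) ^ (-(1:ℝ)/2) * (-z) ^ (-(1:ℝ)/4) * (b - z) ^ (-(1:ℝ)/4) * (1 - z) ^ (-(1:ℝ)/4)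

/-- B₂(a,b) = ∫_{-∞}^a (a-z)^{-1/2}(-z)^{-1/4}(b-z)^{-1/4}(1-z)^{-1/4} dz -/
noncomputable def B2 (a b : ℝ) : ℝ :=
  ∫ z in Iio a, (a - z) ^ (-(1:ℝ)/2) * (-z) ^ (-(1:ℝ)/4) * (b - z) ^ (-(1:ℝ)/4) * (1 - z) ^ (-(1:ℝ)/4)

/-- C₂(a,b) = ∫_b^1 (z-a)^{-1/2} z^{-1/4}(z-b)^{-1/4}(1-z)^{-1/4} dz -/
noncomputable def C2 (a b : ℝ) : ℝ :=
  ∫ z in Ioo b 1, (z - a) ^ (-(1:ℝ)/2) * z ^ (-(1:ℝ)/4) * (z - b) ^ (-(1:ℝ)/4) * (1 - z) ^ (-(1:ℝ)/4)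

/-- The integral of `s ^ (-3/4)` over `(0, c)`, which converges at the singular end point. -/
lemma integrableOn_and_integral_rpow_neg_three_quarters {c : ℝ} (hc : 0 ≤ c) :
    IntegrableOn (fun s : ℝ => s ^ (-(3:ℝ)/4)) (Ioc 0 c) ∧
      ∫ s in Ioc 0 c, s ^ (-(3:ℝ)/4) = 4 * c ^ ((1:ℝ)/4) := by
  constructor
  · rw [← intervalIntegrable_iff_integrableOn_Ioc_of_le hc]
    exact intervalIntegral.intervalIntegrable_rpow' (by norm_num)
  · rw [← intervalIntegral.integral_of_le hc, integral_rpow (Or.inl (by norm_num)),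
      Real.zero_rpow (by norm_num)]
    norm_num
    ring

lemma rpow_quarter_mul_rpow_neg_three_quarters {b : ℝ} (hb : 0 < b) :
    b ^ ((1:ℝ)/4) * b ^ (-(3:ℝ)/4) = b ^ (-(1:ℝ)/2) := by
  rw [← Real.rpow_add hb]
  norm_num

lemma half_le_two_rpow_neg_three_quarters : (1:ℝ)/2 ≤ 2 ^ (-(3:ℝ)/4) := by
  have h : (2:ℝ) ^ (-1:ℝ) ≤ 2 ^ (-(3:ℝ)/4) :=
    Real.rpow_le_rpow_of_exponent_le (by norm_num) (by norm_num)
  rw [Real.rpow_neg_one] at h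
  linarith

lemma rpow_neg_three_quarters_anti {x y : ℝ} (hx : 0 < x) (h : x ≤ y) :
    y ^ (-(3:ℝ)/4) ≤ x ^ (-(3:ℝ)/4) :=
  Real.rpow_le_rpow_of_nonpos hx h (by norm_num)

lemma rpow_neg_three_quarters_le_four {x : ℝ} (hx : 1/4 ≤ x) : x ^ (-(3:ℝ)/4) ≤ 4 := by
  refine (rpow_neg_three_quarters_anti (by norm_num) hx).trans ?_
  have h : ((1:ℝ)/4) ^ (-(3:ℝ)/4) ≤ (1/4) ^ (-1:ℝ) :=
    Real.rpow_le_rpow_of_exponent_ge (by norm_num) (by norm_num) (by norm_num)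
  rw [Real.rpow_neg_one] at h
  linarith

/-- The scale-covariant kernel that governs both integrals: its integral over `(0, ∞)` is of
order `b ^ (-1/2)`. -/
noncomputable def coalescingKernel (b s : ℝ) : ℝ := s ^ (-(3:ℝ)/4) * (s + b) ^ (-(3:ℝ)/4)

lemma measurable_coalescingKernel (b : ℝ) : Measurable (coalescingKernel b) := by
  unfold coalescingKernel
  fun_prop

lemma coalescingKernel_nonneg {b s : ℝ} (hb : 0 ≤ b) (hs : 0 ≤ s) : 0 ≤ coalescingKernel b s := by
  unfold coalescingKernel
  positivity

lemma coalescingKernel_integrableOn_and_integral_le {b : ℝ} (hb : 0 < b) :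
    IntegrableOn (coalescingKernel b) (Ioi 0) ∧
      ∫ s in Ioi 0, coalescingKernel b s ≤ 6 * b ^ (-(1:ℝ)/2) := by
  obtain ⟨hi, hI⟩ := integrableOn_and_integral_rpow_neg_three_quarters hb.le
  have hi' : IntegrableOn (fun s : ℝ => s ^ (-(3:ℝ)/4) * b ^ (-(3:ℝ)/4)) (Ioc 0 b) :=
    Integrable.mul_const hi _
  have hj : IntegrableOn (fun s : ℝ => s ^ (-(3:ℝ)/2)) (Ioi b) :=
    integrableOn_Ioi_rpow_of_lt (by norm_num) hb
  have hJ : ∫ s in Ioi b, s ^ (-(3:ℝ)/2) = 2 * b ^ (-(1:ℝ)/2) := by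
    rw [integral_Ioi_rpow_of_lt (by norm_num) hb]
    norm_num
    ring
  have near : ∀ s ∈ Ioc 0 b, coalescingKernel b s ≤ s ^ (-(3:ℝ)/4) * b ^ (-(3:ℝ)/4) := by
    intro s hs
    exact mul_le_mul_of_nonneg_left (rpow_neg_three_quarters_anti hb (by linarith [hs.1]))
      (Real.rpow_nonneg hs.1.le _)
  have far : ∀ s ∈ Ioi b, coalescingKernel b s ≤ s ^ (-(3:ℝ)/2) := by
    intro s hs
    have hs0 : 0 < s := hb.trans hs
    have hsq : s ^ (-(3:ℝ)/2) = s ^ (-(3:ℝ)/4) * s ^ (-(3:ℝ)/4) := by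
      rw [← Real.rpow_add hs0]
      norm_num
    rw [hsq]
    exact mul_le_mul_of_nonneg_left (rpow_neg_three_quarters_anti hs0 (by linarith))
      (Real.rpow_nonneg hs0.le _)
  have hk : IntegrableOn (coalescingKernel b) (Ioc 0 b) := by
    refine Integrable.mono' hi' (measurable_coalescingKernel b).aestronglyMeasurable ?_
    refine (ae_restrict_mem measurableSet_Ioc).mono fun s hs => ?_
    rw [Real.norm_of_nonneg (coalescingKernel_nonneg hb.le hs.1.le)]
    exact near s hs
  have hk' : IntegrableOn (coalescingKernel b) (Ioi b) := by
    refine Integrable.mono' hj (measurable_coalescingKernel b).aestronglyMeasurable ?_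
    refine (ae_restrict_mem measurableSet_Ioi).mono fun s hs => ?_
    rw [Real.norm_of_nonneg (coalescingKernel_nonneg hb.le (hb.trans hs).le)]
    exact far s hs
  rw [← Ioc_union_Ioi_eq_Ioi hb.le]
  refine ⟨hk.union hk', ?_⟩
  rw [setIntegral_union (Ioc_disjoint_Ioi le_rfl) measurableSet_Ioi hk hk']
  have h1 := setIntegral_mono_on hk hi' measurableSet_Ioc near
  have h2 := setIntegral_mono_on hk' hj measurableSet_Ioi far
  rw [integral_mul_const, hI, mul_assoc, rpow_quarter_mul_rpow_neg_three_quarters hb] at h1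
  linarith

lemma le_integral_coalescingKernel {b : ℝ} (hb : 0 < b) :
    2 * b ^ (-(1:ℝ)/2) ≤ ∫ s in Ioc 0 b, coalescingKernel b s := by
  obtain ⟨hi, hI⟩ := integrableOn_and_integral_rpow_neg_three_quarters hb.le
  have hk := (coalescingKernel_integrableOn_and_integral_le hb).1.mono_set
    (Ioc_subset_Ioi_self (a := b) (b := 0))
  have key : ∀ s ∈ Ioc 0 b, s ^ (-(3:ℝ)/4) * (1/2 * b ^ (-(3:ℝ)/4)) ≤ coalescingKernel b s := by
    intro s hs
    refine mul_le_mul_of_nonneg_left ?_ (Real.rpow_nonneg hs.1.le _)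
    calc 1/2 * b ^ (-(3:ℝ)/4) ≤ 2 ^ (-(3:ℝ)/4) * b ^ (-(3:ℝ)/4) := by
          gcongr
          exact half_le_two_rpow_neg_three_quarters
      _ = (2 * b) ^ (-(3:ℝ)/4) := (Real.mul_rpow (by norm_num) hb.le).symm
      _ ≤ (s + b) ^ (-(3:ℝ)/4) :=
          rpow_neg_three_quarters_anti (by linarith [hs.1]) (by linarith [hs.2])
  have h := setIntegral_mono_on (Integrable.mul_const hi _) hk measurableSet_Ioc key
  rw [integral_mul_const, hI] at h
  linarith [rpow_quarter_mul_rpow_neg_three_quarters hb]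

/-- A weight bounded below near the origin, with an integrable majorant for the weighted kernel,
yields two-sided bounds on the weighted integral. -/
lemma integral_coalescingKernel_mul_bounds {b c m : ℝ} {w G : ℝ → ℝ} (hb : 0 < b) (hbc : b ≤ c)
    (hw : Measurable w) (hw0 : ∀ s ∈ Ioc 0 c, 0 ≤ w s) (hm : ∀ s ∈ Ioc 0 b, m ≤ w s)
    (hG : IntegrableOn G (Ioc 0 c)) (hwG : ∀ s ∈ Ioc 0 c, coalescingKernel b s * w s ≤ G s)
    (hm0 : 0 ≤ m) :
    2 * m * b ^ (-(1:ℝ)/2) ≤ ∫ s in Ioc 0 c, coalescingKernel b s * w s ∧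
      ∫ s in Ioc 0 c, coalescingKernel b s * w s ≤ ∫ s in Ioc 0 c, G s := by
  have hn : ∀ s ∈ Ioc 0 c, 0 ≤ coalescingKernel b s * w s := fun s hs =>
    mul_nonneg (coalescingKernel_nonneg hb.le hs.1.le) (hw0 s hs)
  have hi : IntegrableOn (fun s => coalescingKernel b s * w s) (Ioc 0 c) := by
    refine Integrable.mono' hG ((measurable_coalescingKernel b).mul hw).aestronglyMeasurable ?_
    refine (ae_restrict_mem measurableSet_Ioc).mono fun s hs => ?_
    rw [Real.norm_of_nonneg (hn s hs)]
    exact hwG s hs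
  refine ⟨?_, setIntegral_mono_on hi hG measurableSet_Ioc hwG⟩
  have hsub : Ioc 0 b ⊆ Ioc 0 c := Ioc_subset_Ioc_right hbc
  have hk := (coalescingKernel_integrableOn_and_integral_le hb).1.mono_set
    (Ioc_subset_Ioi_self (a := b) (b := 0))
  calc 2 * m * b ^ (-(1:ℝ)/2) = 2 * b ^ (-(1:ℝ)/2) * m := by ring
    _ ≤ (∫ s in Ioc 0 b, coalescingKernel b s) * m :=
        mul_le_mul_of_nonneg_right (le_integral_coalescingKernel hb) hm0
    _ = ∫ s in Ioc 0 b, coalescingKernel b s * m := (integral_mul_const _ _).symm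
    _ ≤ ∫ s in Ioc 0 b, coalescingKernel b s * w s :=
        setIntegral_mono_on (Integrable.mul_const hk _) (hi.mono_set hsub) measurableSet_Ioc
          fun s hs => mul_le_mul_of_nonneg_left (hm s hs)
            (coalescingKernel_nonneg hb.le hs.1.le)
    _ ≤ ∫ s in Ioc 0 c, coalescingKernel b s * w s :=
        setIntegral_mono_set hi ((ae_restrict_mem measurableSet_Ioc).mono hn) hsub.eventuallyLE

lemma A1_eq_integral_coalescingKernel {a : ℝ} (b : ℝ) (ha : a ≤ 0) :
    A1 a b = ∫ s in Ioc 0 (-a),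
      coalescingKernel b s * ((-a - s) ^ ((1:ℝ)/2) * (1 + s) ^ (-(3:ℝ)/4)) := by
  rw [A1, ← integral_Ioc_eq_integral_Ioo, ← intervalIntegral.integral_of_le ha,
    ← intervalIntegral.integral_of_le (neg_nonneg.2 ha), ← neg_zero,
    ← neg_neg a, ← intervalIntegral.integral_comp_neg]
  simp only [neg_neg, neg_zero]
  refine intervalIntegral.integral_congr fun s _ => ?_
  simp only [coalescingKernel]
  rw [show -s - a = -a - s by ring, show b - -s = s + b by ring, show 1 - -s = 1 + s by ring]
  ring

lemma C1_eq_integral_coalescingKernel (a : ℝ) {b : ℝ} (hb : b ≤ 1) :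
    C1 a b = ∫ s in Ioc 0 (1 - b),
      coalescingKernel b s * ((s + b - a) ^ ((1:ℝ)/2) * (1 - b - s) ^ (-(3:ℝ)/4)) := by
  rw [C1, ← integral_Ioc_eq_integral_Ioo, ← intervalIntegral.integral_of_le hb,
    ← intervalIntegral.integral_of_le (sub_nonneg.2 hb), ← sub_self b,
    ← intervalIntegral.integral_comp_sub_right _ b]
  refine intervalIntegral.integral_congr fun z _ => ?_
  simp only [coalescingKernel]
  rw [show z - b + b = z by ring, show 1 - b - (z - b) = 1 - z by ring]
  ring

lemma A1_bounds {a b : ℝ} (ha : a < 0) (hb : 0 < b) (hb1 : b ≤ 1) (hba : b ≤ -a / 2) :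
    (-a / 2) ^ ((1:ℝ)/2) * b ^ (-(1:ℝ)/2) ≤ A1 a b ∧
      A1 a b ≤ 6 * (-a) ^ ((1:ℝ)/2) * b ^ (-(1:ℝ)/2) := by
  obtain ⟨hi, hI⟩ := coalescingKernel_integrableOn_and_integral_le hb
  have hm0 : 0 ≤ (-a / 2) ^ ((1:ℝ)/2) := Real.rpow_nonneg (by linarith) _
  have hM0 : 0 ≤ (-a) ^ ((1:ℝ)/2) := Real.rpow_nonneg (by linarith) _
  rw [A1_eq_integral_coalescingKernel b ha.le]
  obtain ⟨h1, h2⟩ := integral_coalescingKernel_mul_bounds (b := b) (c := -a)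
    (m := (-a / 2) ^ ((1:ℝ)/2) * (1/2))
    (w := fun s => (-a - s) ^ ((1:ℝ)/2) * (1 + s) ^ (-(3:ℝ)/4))
    (G := fun s => coalescingKernel b s * (-a) ^ ((1:ℝ)/2)) hb (by linarith) (by fun_prop)
    (fun s hs => mul_nonneg (Real.rpow_nonneg (by linarith [hs.2]) _)
      (Real.rpow_nonneg (by linarith [hs.1]) _))
    (fun s hs => by
      refine mul_le_mul (Real.rpow_le_rpow (by linarith) (by linarith [hs.2]) (by norm_num))
        (half_le_two_rpow_neg_three_quarters.trans ?_) (by norm_num)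
        (Real.rpow_nonneg (by linarith [hs.2]) _)
      exact rpow_neg_three_quarters_anti (by linarith [hs.1]) (by linarith [hs.2]))
    (Integrable.mul_const (hi.mono_set Ioc_subset_Ioi_self) _)
    (fun s hs => by
      refine mul_le_mul_of_nonneg_left ?_ (coalescingKernel_nonneg hb.le hs.1.le)
      have hr : (1 + s) ^ (-(3:ℝ)/4) ≤ 1 :=
        Real.rpow_le_one_of_one_le_of_nonpos (by linarith [hs.1]) (by norm_num)
      calc (-a - s) ^ ((1:ℝ)/2) * (1 + s) ^ (-(3:ℝ)/4) ≤ (-a - s) ^ ((1:ℝ)/2) * 1 :=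
            mul_le_mul_of_nonneg_left hr (Real.rpow_nonneg (by linarith [hs.2]) _)
        _ ≤ (-a) ^ ((1:ℝ)/2) := by
            rw [mul_one]
            exact Real.rpow_le_rpow (by linarith [hs.2]) (by linarith [hs.1]) (by norm_num))
    (by positivity)
  refine ⟨by linarith, h2.trans ?_⟩
  rw [integral_mul_const]
  have h3 : ∫ s in Ioc 0 (-a), coalescingKernel b s ≤ ∫ s in Ioi 0, coalescingKernel b s :=
    setIntegral_mono_set hi ((ae_restrict_mem measurableSet_Ioi).mono
      fun s hs => coalescingKernel_nonneg hb.le (le_of_lt hs)) Ioc_subset_Ioi_self.eventuallyLE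
  calc _ ≤ 6 * b ^ (-(1:ℝ)/2) * (-a) ^ ((1:ℝ)/2) :=
        mul_le_mul_of_nonneg_right (h3.trans hI) hM0
    _ = _ := by ring

lemma C1_bounds {a b : ℝ} (ha : a < 0) (hb : 0 < b) (hb4 : b ≤ 1/4) :
    2 * (-a) ^ ((1:ℝ)/2) * b ^ (-(1:ℝ)/2) ≤ C1 a b ∧
      C1 a b ≤ 40 * (1 - a) ^ ((1:ℝ)/2) * b ^ (-(1:ℝ)/2) := by
  obtain ⟨hi, hI⟩ := coalescingKernel_integrableOn_and_integral_le hb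
  have hM0 : 0 ≤ (1 - a) ^ ((1:ℝ)/2) := Real.rpow_nonneg (by linarith) _
  have hc : 0 ≤ 1 - b := by linarith
  have hr : IntegrableOn (fun s : ℝ => (1 - b - s) ^ (-(3:ℝ)/4)) (Ioc 0 (1 - b)) := by
    rw [← intervalIntegrable_iff_integrableOn_Ioc_of_le hc]
    have := (intervalIntegral.intervalIntegrable_rpow' (a := 1 - b) (b := 0)
      (r := -(3:ℝ)/4) (by norm_num)).comp_sub_left (1 - b)
    simpa using this
  have hR : ∫ s in Ioc 0 (1 - b), (1 - b - s) ^ (-(3:ℝ)/4) ≤ 4 := by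
    rw [← intervalIntegral.integral_of_le hc,
      intervalIntegral.integral_comp_sub_left (fun s : ℝ => s ^ (-(3:ℝ)/4)), sub_self, sub_zero,
      intervalIntegral.integral_of_le hc,
      (integrableOn_and_integral_rpow_neg_three_quarters hc).2]
    linarith [Real.rpow_le_one hc (by linarith : 1 - b ≤ 1) (by norm_num : (0:ℝ) ≤ 1/4)]
  have hi' := hi.mono_set (Ioc_subset_Ioi_self (a := 1 - b) (b := 0))
  rw [C1_eq_integral_coalescingKernel a (by linarith)]
  obtain ⟨h1, h2⟩ := integral_coalescingKernel_mul_bounds (b := b) (c := 1 - b)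
    (m := (-a) ^ ((1:ℝ)/2))
    (w := fun s => (s + b - a) ^ ((1:ℝ)/2) * (1 - b - s) ^ (-(3:ℝ)/4))
    (G := fun s => (1 - a) ^ ((1:ℝ)/2) *
      (4 * coalescingKernel b s + 4 * (1 - b - s) ^ (-(3:ℝ)/4))) hb (by linarith) (by fun_prop)
    (fun s hs => mul_nonneg (Real.rpow_nonneg (by linarith [hs.1]) _)
      (Real.rpow_nonneg (by linarith [hs.2]) _))
    (fun s hs => by
      have h1 : 1 ≤ (1 - b - s) ^ (-(3:ℝ)/4) :=
        Real.one_le_rpow_of_pos_of_le_one_of_nonpos (by linarith [hs.2]) (by linarith [hs.1])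
          (by norm_num)
      have h2 : (-a) ^ ((1:ℝ)/2) ≤ (s + b - a) ^ ((1:ℝ)/2) :=
        Real.rpow_le_rpow (by linarith) (by linarith [hs.1]) (by norm_num)
      exact h2.trans (le_mul_of_one_le_right (Real.rpow_nonneg (by linarith [hs.1]) _) h1))
    (Integrable.const_mul ((Integrable.const_mul hi' 4).add (Integrable.const_mul hr 4)) _)
    (fun s hs => by
      have hk0 := coalescingKernel_nonneg hb.le hs.1.le
      have hr0 : 0 ≤ (1 - b - s) ^ (-(3:ℝ)/4) := Real.rpow_nonneg (by linarith [hs.2]) _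
      have hM : (s + b - a) ^ ((1:ℝ)/2) ≤ (1 - a) ^ ((1:ℝ)/2) :=
        Real.rpow_le_rpow (by linarith [hs.1]) (by linarith [hs.2]) (by norm_num)
      have hkr : coalescingKernel b s * (1 - b - s) ^ (-(3:ℝ)/4) ≤
          4 * coalescingKernel b s + 4 * (1 - b - s) ^ (-(3:ℝ)/4) := by
        rcases le_total s (1/2) with h | h
        · have := mul_le_mul_of_nonneg_left
            (rpow_neg_three_quarters_le_four (x := 1 - b - s) (by linarith)) hk0
          linarith
        · have h2 : s ^ (-(3:ℝ)/4) ≤ 2 := by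
            refine (rpow_neg_three_quarters_anti (by norm_num) h).trans ?_
            have h : ((1:ℝ)/2) ^ (-(3:ℝ)/4) ≤ (1/2) ^ (-1:ℝ) :=
              Real.rpow_le_rpow_of_exponent_ge (by norm_num) (by norm_num) (by norm_num)
            rw [Real.rpow_neg_one] at h
            linarith
          have h3 := (rpow_neg_three_quarters_anti hs.1 (by linarith : s ≤ s + b)).trans h2
          have hk : coalescingKernel b s ≤ 2 * 2 :=
            mul_le_mul h2 h3 (Real.rpow_nonneg (by linarith [hs.1]) _) (by norm_num)
          have := mul_le_mul_of_nonneg_right hk hr0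
          linarith
      calc _ = (s + b - a) ^ ((1:ℝ)/2) *
            (coalescingKernel b s * (1 - b - s) ^ (-(3:ℝ)/4)) := by ring
        _ ≤ _ := mul_le_mul hM hkr (mul_nonneg hk0 hr0) hM0)
    (Real.rpow_nonneg (by linarith) _)
  refine ⟨h1, h2.trans ?_⟩
  rw [integral_const_mul, integral_add (Integrable.const_mul hi' 4) (Integrable.const_mul hr 4),
    integral_const_mul, integral_const_mul]
  have h3 : ∫ s in Ioc 0 (1 - b), coalescingKernel b s ≤ ∫ s in Ioi 0, coalescingKernel b s :=
    setIntegral_mono_set hi ((ae_restrict_mem measurableSet_Ioi).mono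
      fun s hs => coalescingKernel_nonneg hb.le (le_of_lt hs)) Ioc_subset_Ioi_self.eventuallyLE
  have h4 : 1 ≤ b ^ (-(1:ℝ)/2) :=
    Real.one_le_rpow_of_pos_of_le_one_of_nonpos hb (by linarith) (by norm_num)
  calc _ ≤ (1 - a) ^ ((1:ℝ)/2) * (40 * b ^ (-(1:ℝ)/2)) :=
        mul_le_mul_of_nonneg_left (by linarith) hM0
    _ = _ := by ring

theorem cs4_A1C1_asymptotics_near_zero :
    ∀ a : ℝ, a < 0 → ∃ C δ : ℝ, 0 < C ∧ δ ∈ Ioo (0:ℝ) 1 ∧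
      ∀ b ∈ Ioo (0:ℝ) δ,
        ((1 / C) * b ^ (-(1:ℝ)/2) ≤ A1 a b ∧ A1 a b ≤ C * b ^ (-(1:ℝ)/2)) ∧
        ((1 / C) * b ^ (-(1:ℝ)/2) ≤ C1 a b ∧ C1 a b ≤ C * b ^ (-(1:ℝ)/2)) := by
  intro a ha
  set m : ℝ := (-a / 2) ^ ((1:ℝ)/2)
  set M : ℝ := (1 - a) ^ ((1:ℝ)/2)
  have hm0 : 0 < m := Real.rpow_pos_of_pos (by linarith) _
  have hM0 : 0 < M := Real.rpow_pos_of_pos (by linarith) _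
  have hma : m ≤ (-a) ^ ((1:ℝ)/2) := Real.rpow_le_rpow (by linarith) (by linarith) (by norm_num)
  have haM : (-a) ^ ((1:ℝ)/2) ≤ M := Real.rpow_le_rpow (by linarith) (by linarith) (by norm_num)
  have hC : 1 / (40 * M + 1 / m) ≤ m := by
    rw [one_div_le (by positivity) hm0]
    linarith
  have hmi : 0 < 1 / m := by positivity
  refine ⟨40 * M + 1 / m, min (1/4) (-a / 2), by positivity,
    ⟨lt_min (by norm_num) (by linarith), (min_le_left _ _).trans_lt (by norm_num)⟩, ?_⟩
  intro b hb
  have hb4 : b ≤ 1/4 := hb.2.le.trans (min_le_left _ _)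
  obtain ⟨hA1, hA2⟩ := A1_bounds ha hb.1 (by linarith) (hb.2.le.trans (min_le_right _ _))
  obtain ⟨hC1, hC2⟩ := C1_bounds ha hb.1 hb4
  have hb0 : 0 ≤ b ^ (-(1:ℝ)/2) := Real.rpow_nonneg hb.1.le _
  refine ⟨⟨le_trans ?_ hA1, hA2.trans ?_⟩, ⟨le_trans ?_ hC1, hC2.trans ?_⟩⟩ <;>
    exact mul_le_mul_of_nonneg_right (by linarith) hb0
end

section
/- For each fixed real a < 0 there exists δ ∈ (0,1) such that for all b ∈ (0,δ): (B₁(a,b) + C₁(a,b))/A₁(a,b) < (B₂(a,b) + C₂(a,b))/A₂(a,b). (The comparison of the two period ratios for b sufficiently close to 0, used in the intermediate-value argument for the CS-4 family.) -/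
open MeasureTheory Set

open Filter Topology

theorem MeasureTheory.IntegrableOn.of_nonneg_of_le {f g : ℝ → ℝ} {S : Set ℝ}
    (hS : MeasurableSet S) (hf : Measurable f) (hg : IntegrableOn g S)
    (h0 : ∀ z ∈ S, 0 ≤ f z) (hfg : ∀ z ∈ S, f z ≤ g z) : IntegrableOn f S := by
  refine Integrable.mono' hg hf.aestronglyMeasurable ?_
  filter_upwards [ae_restrict_mem hS] with z hz
  rw [Real.norm_of_nonneg (h0 z hz)]
  exact hfg z hz

theorem setIntegral_mono_of_nonneg {f g : ℝ → ℝ} {S : Set ℝ}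
    (hS : MeasurableSet S) (hg : IntegrableOn g S)
    (h0 : ∀ z ∈ S, 0 ≤ f z) (hfg : ∀ z ∈ S, f z ≤ g z) :
    ∫ z in S, f z ≤ ∫ z in S, g z :=
  integral_mono_of_nonneg ((ae_restrict_mem hS).mono h0) hg ((ae_restrict_mem hS).mono hfg)

theorem integrableOn_sub_left_rpow {p q α : ℝ} (hα : -1 < α) :
    IntegrableOn (fun z : ℝ => (z - p) ^ α) (Ioo p q) := by
  rcases le_total q p with h | h
  · simp [Ioo_eq_empty_of_le h]
  have := (intervalIntegral.intervalIntegrable_rpow' (a := 0) (b := q - p) hα).comp_sub_right p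
  simp only [zero_add, sub_add_cancel] at this
  exact ((intervalIntegrable_iff_integrableOn_Ioc_of_le h).1 this).mono_set Ioo_subset_Ioc_self

theorem integrableOn_sub_right_rpow {p q α : ℝ} (hα : -1 < α) :
    IntegrableOn (fun z : ℝ => (q - z) ^ α) (Ioo p q) := by
  rcases le_total q p with h | h
  · simp [Ioo_eq_empty_of_le h]
  have := (intervalIntegral.intervalIntegrable_rpow' (a := 0) (b := q - p) hα).comp_sub_left q
  simp only [sub_zero, sub_sub_cancel] at this
  exact ((intervalIntegrable_iff_integrableOn_Ioc_of_le h).1 this.symm).mono_set Ioo_subset_Ioc_self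

theorem setIntegral_sub_left_rpow {p q α : ℝ} (hpq : p ≤ q) (hα : -1 < α) :
    ∫ z in Ioo p q, (z - p) ^ α = (q - p) ^ (α + 1) / (α + 1) := by
  rw [← integral_Ioc_eq_integral_Ioo, ← intervalIntegral.integral_of_le hpq,
    intervalIntegral.integral_comp_sub_right (fun x => x ^ α) p, integral_rpow (Or.inl hα),
    sub_self, Real.zero_rpow (by linarith), sub_zero]

/-- Convergence of a Beta-type integral with nonpositive exponents. -/
theorem integrableOn_mul_rpow {p q α β : ℝ} (hα : -1 < α) (hβ : -1 < β)
    (hα0 : α ≤ 0) (hβ0 : β ≤ 0) :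
    IntegrableOn (fun z : ℝ => (z - p) ^ α * (q - z) ^ β) (Ioo p q) := by
  rcases le_or_gt q p with h | h
  · simp [Ioo_eq_empty_of_le h]
  have hm : 0 < (q - p) / 2 := by linarith
  refine IntegrableOn.of_nonneg_of_le (g := fun z => ((q - p) / 2) ^ α * (q - z) ^ β +
      (z - p) ^ α * ((q - p) / 2) ^ β) measurableSet_Ioo (by fun_prop)
    (((integrableOn_sub_right_rpow hβ).const_mul _).add
      ((integrableOn_sub_left_rpow hα).mul_const _)) ?_ ?_
  · rintro z ⟨h1, h2⟩
    have := sub_pos.2 h1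
    have := sub_pos.2 h2
    positivity
  · rintro z ⟨h1, h2⟩
    have h1' := sub_pos.2 h1
    have h2' := sub_pos.2 h2
    rcases le_total ((q - p) / 2) (z - p) with h | h
    · have h3 := Real.rpow_le_rpow_of_nonpos hm h hα0
      have : 0 ≤ (z - p) ^ α * ((q - p) / 2) ^ β := by positivity
      have h4 : 0 ≤ (q - z) ^ β := by positivity
      nlinarith [mul_le_mul_of_nonneg_right h3 h4]
    · have h3 := Real.rpow_le_rpow_of_nonpos hm (show (q - p) / 2 ≤ q - z by linarith) hβ0
      have : 0 ≤ ((q - p) / 2) ^ α * (q - z) ^ β := by positivity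
      have h4 : 0 ≤ (z - p) ^ α := by positivity
      nlinarith [mul_le_mul_of_nonneg_left h3 h4]

theorem exists_B1_le {a : ℝ} (ha : a < 0) : ∃ M, ∀ b, 0 < b → B1 a b ≤ M := by
  refine ⟨∫ z in Iio a, (-z) ^ (-(7:ℝ)/4), fun b hb => ?_⟩
  refine setIntegral_mono_of_nonneg measurableSet_Iio ?_ ?_ ?_
  · have h := (integrableOn_Ioi_rpow_of_lt (a := -(7:ℝ)/4) (by norm_num) (neg_pos.2 ha)).comp_neg
    simpa using h
  · intro z (hz : z < a)
    have h1 : 0 < a - z := by linarith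
    have h2 : 0 < -z := by linarith
    have h3 : 0 < b - z := by linarith
    have h4 : 0 < 1 - z := by linarith
    positivity
  · intro z (hz : z < a)
    have h1 : 0 < a - z := by linarith
    have h2 : 0 < -z := by linarith
    have h3 : 0 < b - z := by linarith
    have h4 : 0 < 1 - z := by linarith
    calc _ ≤ (-z) ^ ((1:ℝ)/2) * (-z) ^ (-(3:ℝ)/4) * (-z) ^ (-(3:ℝ)/4) * (-z) ^ (-(3:ℝ)/4) := by
          have e1 : (a - z) ^ ((1:ℝ)/2) ≤ (-z) ^ ((1:ℝ)/2) :=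
            Real.rpow_le_rpow h1.le (by linarith) (by norm_num)
          have e2 : (b - z) ^ (-(3:ℝ)/4) ≤ (-z) ^ (-(3:ℝ)/4) :=
            Real.rpow_le_rpow_of_nonpos h2 (by linarith) (by norm_num)
          have e3 : (1 - z) ^ (-(3:ℝ)/4) ≤ (-z) ^ (-(3:ℝ)/4) :=
            Real.rpow_le_rpow_of_nonpos h2 (by linarith) (by norm_num)
          gcongr
      _ = _ := by
          rw [← Real.rpow_add h2, ← Real.rpow_add h2, ← Real.rpow_add h2]
          norm_num

theorem A1_integrand_nonneg {a b z : ℝ} (hb : 0 < b) (hz : z ∈ Ioo a 0) :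
    0 ≤ (z - a) ^ ((1:ℝ)/2) * (-z) ^ (-(3:ℝ)/4) * (b - z) ^ (-(3:ℝ)/4) *
      (1 - z) ^ (-(3:ℝ)/4) := by
  obtain ⟨hz1, hz2⟩ := hz
  have h1 : 0 < z - a := by linarith
  have h2 : 0 < -z := by linarith
  have h3 : 0 < b - z := by linarith
  have h4 : 0 < 1 - z := by linarith
  positivity

theorem integrableOn_A1 {a b : ℝ} (hb : 0 < b) :
    IntegrableOn (fun z : ℝ => (z - a) ^ ((1:ℝ)/2) * (-z) ^ (-(3:ℝ)/4) *
      (b - z) ^ (-(3:ℝ)/4) * (1 - z) ^ (-(3:ℝ)/4)) (Ioo a 0) := by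
  have hi := integrableOn_sub_right_rpow (p := a) (q := 0) (α := -(3:ℝ)/4) (by norm_num)
  simp only [zero_sub] at hi
  refine IntegrableOn.of_nonneg_of_le (g := fun z => (-a) ^ ((1:ℝ)/2) * (-z) ^ (-(3:ℝ)/4) *
    b ^ (-(3:ℝ)/4) * 1 ^ (-(3:ℝ)/4)) measurableSet_Ioo (by fun_prop)
    (((hi.const_mul _).mul_const _).mul_const _) (fun z => A1_integrand_nonneg hb) ?_
  rintro z ⟨hz1, hz2⟩
  have h1 : 0 < z - a := by linarith
  have h2 : 0 < -z := by linarith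
  have h3 : 0 < b - z := by linarith
  have h4 : 0 < 1 - z := by linarith
  have h5 : 0 < -a := by linarith
  have e1 : (z - a) ^ ((1:ℝ)/2) ≤ (-a) ^ ((1:ℝ)/2) :=
    Real.rpow_le_rpow h1.le (by linarith) (by norm_num)
  have e2 : (b - z) ^ (-(3:ℝ)/4) ≤ b ^ (-(3:ℝ)/4) :=
    Real.rpow_le_rpow_of_nonpos hb (by linarith) (by norm_num)
  have e3 : (1 - z) ^ (-(3:ℝ)/4) ≤ 1 ^ (-(3:ℝ)/4) :=
    Real.rpow_le_rpow_of_nonpos one_pos (by linarith) (by norm_num)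
  gcongr

theorem tendsto_A1_atTop {a : ℝ} (ha : a < 0) : Tendsto (A1 a) (𝓝[>] 0) atTop := by
  have hc : 0 < (-a / 2) ^ ((1:ℝ)/2) * 2 ^ (-(3:ℝ)/4) * 2 ^ (-(3:ℝ)/4) := by
    have : 0 < -a / 2 := by linarith
    positivity
  refine tendsto_atTop_mono' _ ?_ ((tendsto_rpow_neg_nhdsGT_zero
    (show -(1:ℝ)/2 < 0 by norm_num)).const_mul_atTop hc)
  filter_upwards [Ioo_mem_nhdsGT (show 0 < min 1 (-a / 2) from
    lt_min one_pos (by linarith))] with b hb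
  obtain ⟨hb, hb'⟩ := hb
  have hb1 : b < 1 := hb'.trans_le (min_le_left _ _)
  have hb2 : b < -a / 2 := hb'.trans_le (min_le_right _ _)
  have hsub : Ioo (-b) 0 ⊆ Ioo a 0 := Ioo_subset_Ioo_left (by linarith)
  calc _ = ∫ z in Ioo (-b) 0, (-a / 2) ^ ((1:ℝ)/2) * b ^ (-(3:ℝ)/4) * (2 * b) ^ (-(3:ℝ)/4) *
        2 ^ (-(3:ℝ)/4) := by
        rw [setIntegral_const, Measure.real, Real.volume_Ioo, sub_neg_eq_add, zero_add,
          ENNReal.toReal_ofReal hb.le, smul_eq_mul, Real.mul_rpow two_pos.le hb.le]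
        have : b ^ (-(1:ℝ)/2) = b * b ^ (-(3:ℝ)/4) * b ^ (-(3:ℝ)/4) := by
          nth_rw 2 [← Real.rpow_one b]
          rw [← Real.rpow_add hb, ← Real.rpow_add hb]
          norm_num
        rw [this]
        ring
    _ ≤ ∫ z in Ioo (-b) 0, (z - a) ^ ((1:ℝ)/2) * (-z) ^ (-(3:ℝ)/4) * (b - z) ^ (-(3:ℝ)/4) *
        (1 - z) ^ (-(3:ℝ)/4) := by
        refine setIntegral_mono_of_nonneg measurableSet_Ioo ((integrableOn_A1 hb).mono_set hsub)
          ?_ ?_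
        · intro z _
          have : 0 < -a / 2 := by linarith
          positivity
        · rintro z ⟨hz1, hz2⟩
          have h1 : 0 < z - a := by linarith
          have h2 : 0 < -z := by linarith
          have h3 : 0 < b - z := by linarith
          have h4 : 0 < 1 - z := by linarith
          have h5 : 0 < -a / 2 := by linarith
          have e1 : (-a / 2) ^ ((1:ℝ)/2) ≤ (z - a) ^ ((1:ℝ)/2) :=
            Real.rpow_le_rpow h5.le (by linarith) (by norm_num)
          have e0 : b ^ (-(3:ℝ)/4) ≤ (-z) ^ (-(3:ℝ)/4) :=
            Real.rpow_le_rpow_of_nonpos h2 (by linarith) (by norm_num)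
          have e2 : (2 * b) ^ (-(3:ℝ)/4) ≤ (b - z) ^ (-(3:ℝ)/4) :=
            Real.rpow_le_rpow_of_nonpos h3 (by linarith) (by norm_num)
          have e3 : 2 ^ (-(3:ℝ)/4) ≤ (1 - z) ^ (-(3:ℝ)/4) :=
            Real.rpow_le_rpow_of_nonpos h4 (by linarith) (by norm_num)
          gcongr
    _ ≤ A1 a b := setIntegral_mono_set (integrableOn_A1 hb)
        ((ae_restrict_mem measurableSet_Ioo).mono fun z => A1_integrand_nonneg hb)
        hsub.eventuallyLE

/-- The reflection `z ↦ b - z` moves the singular point `b` of `C1` to the origin. -/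
theorem C1_eq_reflected (a b : ℝ) :
    C1 a b = ∫ z in Ioo (b - 1) 0, (b - z - a) ^ ((1:ℝ)/2) * (b - z) ^ (-(3:ℝ)/4) *
      (-z) ^ (-(3:ℝ)/4) * (1 - b + z) ^ (-(3:ℝ)/4) := by
  rw [C1, ← integral_indicator measurableSet_Ioo, ← integral_indicator measurableSet_Ioo,
    ← integral_sub_left_eq_self _ volume b]
  congr 1 with z
  by_cases hz : z ∈ Ioo (b - 1) 0
  · rw [indicator_of_mem hz, indicator_of_mem (by constructor <;> linarith [hz.1, hz.2])]
    ring_nf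
  · rw [indicator_of_notMem hz, indicator_of_notMem fun h => hz
      (by constructor <;> linarith [h.1, h.2])]

theorem exists_C1_le {a ε : ℝ} (ha : a < 0) (hε : 0 < ε) :
    ∃ M, ∀ᶠ b in 𝓝[>] 0, C1 a b ≤ (1 + ε) * A1 a b + M := by
  have hs : 0 < -a := by linarith
  have hev : ∀ᶠ p : ℝ × ℝ in 𝓝 (0, 0),
      (p.1 - p.2 - a) ^ ((1:ℝ)/2) * (1 - p.1 + p.2) ^ (-(3:ℝ)/4) <
      (1 + ε) * ((p.2 - a) ^ ((1:ℝ)/2) * (1 - p.2) ^ (-(3:ℝ)/4)) := by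
    refine ContinuousAt.eventually_lt ?_ ?_ ?_
    · refine (ContinuousAt.rpow_const (by fun_prop) (Or.inr (by norm_num))).mul
        (ContinuousAt.rpow_const (by fun_prop) (Or.inl (by norm_num)))
    · refine continuousAt_const.mul
        ((ContinuousAt.rpow_const (by fun_prop) (Or.inr (by norm_num))).mul
        (ContinuousAt.rpow_const (by fun_prop) (Or.inl (by norm_num))))
    · have : 0 < (-a) ^ ((1:ℝ)/2) := by positivity
      simp only [sub_zero, zero_sub, add_zero, Real.one_rpow, mul_one]
      nlinarith
  obtain ⟨r, hr, hball⟩ := Metric.eventually_nhds_iff.1 hev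
  obtain ⟨η, hη, hη'⟩ := exists_between (lt_min hr hs)
  have hηr : η < r := hη'.trans_le (min_le_left _ _)
  have hηs : η < -a := hη'.trans_le (min_le_right _ _)
  refine ⟨(1 - a) ^ ((1:ℝ)/2) * η ^ (-(3:ℝ)/4) * η ^ (-(3:ℝ)/4) * 4, ?_⟩
  filter_upwards [Ioo_mem_nhdsGT (lt_min one_pos hr)] with b hb
  obtain ⟨hb, hb'⟩ := hb
  have hb1 : b < 1 := hb'.trans_le (min_le_left _ _)
  have hbr : b < r := hb'.trans_le (min_le_right _ _)
  have hsub : Ioo (-η) 0 ⊆ Ioo a 0 := Ioo_subset_Ioo_left (by linarith)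
  set F : ℝ → ℝ := fun z => (z - a) ^ ((1:ℝ)/2) * (-z) ^ (-(3:ℝ)/4) * (b - z) ^ (-(3:ℝ)/4) *
    (1 - z) ^ (-(3:ℝ)/4) with hF
  set K : ℝ := (1 - a) ^ ((1:ℝ)/2) * η ^ (-(3:ℝ)/4) * η ^ (-(3:ℝ)/4) with hK
  have hK0 : 0 < K := by
    have : 0 < 1 - a := by linarith
    positivity
  have hFη : Integrable ((Ioo (-η) 0).indicator F) :=
    (integrable_indicator_iff measurableSet_Ioo).2 ((integrableOn_A1 hb).mono_set hsub)
  have hF0 : ∀ z, 0 ≤ (Ioo (-η) 0).indicator F z :=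
    fun z => indicator_nonneg (fun z hz => A1_integrand_nonneg hb (hsub hz)) z
  have hp : IntegrableOn (fun z : ℝ => (z - (b - 1)) ^ (-(3:ℝ)/4)) (Ioo (b - 1) 0) :=
    integrableOn_sub_left_rpow (by norm_num)
  have key : C1 a b ≤ ∫ z in Ioo (b - 1) 0,
      ((1 + ε) * (Ioo (-η) 0).indicator F z + K * (z - (b - 1)) ^ (-(3:ℝ)/4)) := by
    rw [C1_eq_reflected]
    refine setIntegral_mono_of_nonneg measurableSet_Ioo
      ((hFη.integrableOn.const_mul _).add (hp.const_mul _)) ?_ ?_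
    · rintro z ⟨hz1, hz2⟩
      have h1 : 0 < b - z - a := by linarith
      have h2 : 0 < -z := by linarith
      have h3 : 0 < b - z := by linarith
      have h4 : 0 < 1 - b + z := by linarith
      positivity
    · rintro z ⟨hz1, hz2⟩
      have h1 : 0 < b - z - a := by linarith
      have h2 : 0 < -z := by linarith
      have h3 : 0 < b - z := by linarith
      have h4 : 0 < z - (b - 1) := by linarith
      have h6 : 0 < 1 - a := by linarith
      have h5 : 1 - b + z = z - (b - 1) := by ring
      by_cases hz : z ∈ Ioo (-η) 0
      · rw [indicator_of_mem hz]
        have hlt := @hball (b, z) (by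
          rw [Prod.dist_eq, max_lt_iff, Real.dist_eq, Real.dist_eq, sub_zero, sub_zero,
            abs_of_pos hb, abs_of_neg hz2]
          exact ⟨hbr, by linarith [hz.1]⟩)
        simp only at hlt
        have hk : 0 ≤ (-z) ^ (-(3:ℝ)/4) * (b - z) ^ (-(3:ℝ)/4) := by positivity
        have := mul_le_mul_of_nonneg_right hlt.le hk
        have h7 : 0 ≤ K * (z - (b - 1)) ^ (-(3:ℝ)/4) := by positivity
        simp only [hF]
        linarith
      · rw [indicator_of_notMem hz, mul_zero, zero_add, h5]
        have hz' : η ≤ -z := by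
          by_contra! h
          exact hz ⟨by linarith, hz2⟩
        have e1 : (b - z - a) ^ ((1:ℝ)/2) ≤ (1 - a) ^ ((1:ℝ)/2) :=
          Real.rpow_le_rpow h1.le (by linarith) (by norm_num)
        have e2 : (b - z) ^ (-(3:ℝ)/4) ≤ η ^ (-(3:ℝ)/4) :=
          Real.rpow_le_rpow_of_nonpos hη (by linarith) (by norm_num)
        have e3 : (-z) ^ (-(3:ℝ)/4) ≤ η ^ (-(3:ℝ)/4) :=
          Real.rpow_le_rpow_of_nonpos hη hz' (by norm_num)
        rw [hK]
        gcongr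
  have hA : ∫ z in Ioo (b - 1) 0, (Ioo (-η) 0).indicator F z ≤ A1 a b :=
    calc _ ≤ ∫ z, (Ioo (-η) 0).indicator F z :=
          setIntegral_le_integral hFη (Eventually.of_forall hF0)
      _ = ∫ z in Ioo (-η) 0, F z := integral_indicator measurableSet_Ioo
      _ ≤ A1 a b := setIntegral_mono_set (integrableOn_A1 hb)
          ((ae_restrict_mem measurableSet_Ioo).mono fun z => A1_integrand_nonneg hb)
          hsub.eventuallyLE
  have h4 : ∫ z in Ioo (b - 1) 0, (z - (b - 1)) ^ (-(3:ℝ)/4) ≤ 4 := by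
    rw [setIntegral_sub_left_rpow (by linarith) (by norm_num)]
    have : (0 - (b - 1)) ^ (-(3:ℝ)/4 + 1) ≤ 1 :=
      Real.rpow_le_one (by linarith) (by linarith) (by norm_num)
    norm_num at this ⊢
    linarith
  rw [integral_add (hFη.integrableOn.const_mul _) (hp.const_mul _), integral_const_mul,
    integral_const_mul] at key
  have := mul_le_mul_of_nonneg_left hA (show 0 ≤ 1 + ε by linarith)
  have := mul_le_mul_of_nonneg_left h4 hK0.le
  linarith

theorem A2_integrand_pos {a b z : ℝ} (hb : 0 < b) (hz : z ∈ Ioo a 0) :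
    0 < (z - a) ^ (-(1:ℝ)/2) * (-z) ^ (-(1:ℝ)/4) * (b - z) ^ (-(1:ℝ)/4) *
      (1 - z) ^ (-(1:ℝ)/4) := by
  obtain ⟨hz1, hz2⟩ := hz
  have h1 : 0 < z - a := by linarith
  have h2 : 0 < -z := by linarith
  have h3 : 0 < b - z := by linarith
  have h4 : 0 < 1 - z := by linarith
  positivity

theorem exists_A2_le {a : ℝ} (ha : a < 0) :
    ∃ K, ∀ b, 0 < b → 0 < A2 a b ∧ A2 a b ≤ K := by
  have hi := integrableOn_mul_rpow (p := a) (q := 0) (α := -(1:ℝ)/2) (β := -(1:ℝ)/2)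
    (by norm_num) (by norm_num) (by norm_num) (by norm_num)
  refine ⟨∫ z in Ioo a 0, (z - a) ^ (-(1:ℝ)/2) * (0 - z) ^ (-(1:ℝ)/2), fun b hb => ?_⟩
  have hle : ∀ z ∈ Ioo a 0, (z - a) ^ (-(1:ℝ)/2) * (-z) ^ (-(1:ℝ)/4) * (b - z) ^ (-(1:ℝ)/4) *
      (1 - z) ^ (-(1:ℝ)/4) ≤ (z - a) ^ (-(1:ℝ)/2) * (0 - z) ^ (-(1:ℝ)/2) := by
    rintro z ⟨hz1, hz2⟩
    have h1 : 0 < z - a := by linarith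
    have h2 : 0 < -z := by linarith
    have h3 : 0 < b - z := by linarith
    have h4 : 0 < 1 - z := by linarith
    calc _ ≤ (z - a) ^ (-(1:ℝ)/2) * (-z) ^ (-(1:ℝ)/4) * (-z) ^ (-(1:ℝ)/4) * 1 := by
          have e2 : (b - z) ^ (-(1:ℝ)/4) ≤ (-z) ^ (-(1:ℝ)/4) :=
            Real.rpow_le_rpow_of_nonpos h2 (by linarith) (by norm_num)
          have e3 : (1 - z) ^ (-(1:ℝ)/4) ≤ 1 :=
            Real.rpow_le_one_of_one_le_of_nonpos (by linarith) (by norm_num)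
          gcongr
      _ = _ := by
          rw [mul_one, mul_assoc, ← Real.rpow_add h2]
          norm_num
  constructor
  · refine (setIntegral_pos_iff_support_of_nonneg_ae
      ((ae_restrict_mem measurableSet_Ioo).mono fun z hz => (A2_integrand_pos hb hz).le)
      (IntegrableOn.of_nonneg_of_le measurableSet_Ioo (by fun_prop) hi
        (fun z hz => (A2_integrand_pos hb hz).le) hle)).2 ?_
    refine lt_of_lt_of_le ?_ (measure_mono (subset_inter
      (fun z hz => Function.mem_support.2 (A2_integrand_pos hb hz).ne') subset_rfl))
    simpa using ha
  · exact setIntegral_mono_of_nonneg measurableSet_Ioo hi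
      (fun z hz => (A2_integrand_pos hb hz).le) hle

theorem le_C2 {a b : ℝ} (ha : a < 0) (hb : 0 < b) (hb1 : b ≤ 1) :
    (1 - b) * (1 - a) ^ (-(1:ℝ)/2) ≤ C2 a b := by
  have hi := integrableOn_mul_rpow (p := b) (q := 1) (α := -(1:ℝ)/2) (β := -(1:ℝ)/4)
    (by norm_num) (by norm_num) (by norm_num) (by norm_num)
  have h0 : ∀ z ∈ Ioo b 1, 0 ≤ (z - a) ^ (-(1:ℝ)/2) * z ^ (-(1:ℝ)/4) * (z - b) ^ (-(1:ℝ)/4) *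
      (1 - z) ^ (-(1:ℝ)/4) := by
    rintro z ⟨hz1, hz2⟩
    have h1 : 0 < z - a := by linarith
    have h2 : 0 < z := by linarith
    have h3 : 0 < z - b := by linarith
    have h4 : 0 < 1 - z := by linarith
    positivity
  have hint : IntegrableOn (fun z : ℝ => (z - a) ^ (-(1:ℝ)/2) * z ^ (-(1:ℝ)/4) *
      (z - b) ^ (-(1:ℝ)/4) * (1 - z) ^ (-(1:ℝ)/4)) (Ioo b 1) := by
    refine IntegrableOn.of_nonneg_of_le measurableSet_Ioo (by fun_prop)
      (hi.const_mul ((-a) ^ (-(1:ℝ)/2))) h0 ?_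
    rintro z ⟨hz1, hz2⟩
    have h1 : 0 < z - a := by linarith
    have h2 : 0 < z := by linarith
    have h3 : 0 < z - b := by linarith
    have h4 : 0 < 1 - z := by linarith
    have h5 : 0 < -a := by linarith
    calc _ ≤ (-a) ^ (-(1:ℝ)/2) * (z - b) ^ (-(1:ℝ)/4) * (z - b) ^ (-(1:ℝ)/4) *
          (1 - z) ^ (-(1:ℝ)/4) := by
          have e1 : (z - a) ^ (-(1:ℝ)/2) ≤ (-a) ^ (-(1:ℝ)/2) :=
            Real.rpow_le_rpow_of_nonpos h5 (by linarith) (by norm_num)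
          have e2 : z ^ (-(1:ℝ)/4) ≤ (z - b) ^ (-(1:ℝ)/4) :=
            Real.rpow_le_rpow_of_nonpos h3 (by linarith) (by norm_num)
          gcongr
      _ = _ := by
          rw [mul_assoc (_ ^ _) ((z - b) ^ _), ← Real.rpow_add h3, mul_assoc]
          norm_num
  calc _ = ∫ z in Ioo b 1, (1 - a) ^ (-(1:ℝ)/2) := by
        rw [setIntegral_const, Measure.real, Real.volume_Ioo,
          ENNReal.toReal_ofReal (by linarith), smul_eq_mul]
    _ ≤ C2 a b := by
        refine setIntegral_mono_of_nonneg measurableSet_Ioo hint (fun z _ => ?_) ?_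
        · have : 0 < 1 - a := by linarith
          positivity
        · rintro z ⟨hz1, hz2⟩
          have h1 : 0 < z - a := by linarith
          have h2 : 0 < z := by linarith
          have h3 : 0 < z - b := by linarith
          have h4 : 0 < 1 - z := by linarith
          calc (1 - a) ^ (-(1:ℝ)/2) = (1 - a) ^ (-(1:ℝ)/2) * 1 * 1 * 1 := by ring
            _ ≤ _ := by
              have e1 : (1 - a) ^ (-(1:ℝ)/2) ≤ (z - a) ^ (-(1:ℝ)/2) :=
                Real.rpow_le_rpow_of_nonpos h1 (by linarith) (by norm_num)
              have e2 : 1 ≤ z ^ (-(1:ℝ)/4) :=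
                Real.one_le_rpow_of_pos_of_le_one_of_nonpos h2 (by linarith) (by norm_num)
              have e3 : 1 ≤ (z - b) ^ (-(1:ℝ)/4) :=
                Real.one_le_rpow_of_pos_of_le_one_of_nonpos h3 (by linarith) (by norm_num)
              have e4 : 1 ≤ (1 - z) ^ (-(1:ℝ)/4) :=
                Real.one_le_rpow_of_pos_of_le_one_of_nonpos h4 (by linarith) (by norm_num)
              gcongr

theorem image_sq_div_Ioo {a : ℝ} (ha : a < 0) : (fun z => a ^ 2 / z) '' Ioo a 0 = Iio a := by
  have ha2 : 0 < a ^ 2 := sq_pos_of_neg ha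
  ext x
  constructor
  · rintro ⟨z, ⟨hz1, hz2⟩, rfl⟩
    simp only [mem_Iio]
    rw [div_lt_iff_of_neg hz2]
    nlinarith
  · intro (hx : x < a)
    have hx0 : x < 0 := hx.trans ha
    refine ⟨a ^ 2 / x, ⟨?_, div_neg_of_pos_of_neg ha2 hx0⟩, ?_⟩
    · rw [lt_div_iff_of_neg hx0]
      nlinarith
    · exact div_div_cancel₀ ha2.ne'

/-- The involution `z ↦ a ^ 2 / z` exchanges the domains of `B2` and `A2`, and compares the
integrands pointwise. -/
theorem A2_le_B2 {a b : ℝ} (ha : a < 0) (hb : 0 < b) : A2 a b ≤ B2 a b := by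
  have hderiv : ∀ z ∈ Ioo a 0, HasDerivWithinAt (fun z => a ^ 2 / z) (-(a ^ 2) / z ^ 2)
      (Ioo a 0) z := fun z hz => by
    simpa using ((hasDerivAt_const z (a ^ 2)).fun_div (hasDerivAt_id' z) hz.2.ne).hasDerivWithinAt
      (s := Ioo a 0)
  have hinj : InjOn (fun z => a ^ 2 / z) (Ioo a 0) := by
    intro x _ y _ h
    have ha2 : a ^ 2 ≠ 0 := pow_ne_zero 2 ha.ne
    rw [← div_div_cancel₀ ha2 (b := x), ← div_div_cancel₀ ha2 (b := y)]
    exact congrArg (a ^ 2 / ·) h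
  rw [A2, B2, ← image_sq_div_Ioo ha,
    integral_image_eq_integral_abs_deriv_smul measurableSet_Ioo hderiv hinj]
  have hi := integrableOn_mul_rpow (p := a) (q := 0) (α := -(1:ℝ)/2) (β := -(3:ℝ)/4)
    (by norm_num) (by norm_num) (by norm_num) (by norm_num)
  have hcoord : ∀ z ∈ Ioo a 0, 0 < z - a ∧ 0 < -z ∧ 0 < a / z ∧
      |-(a ^ 2) / z ^ 2| = (a / z) ^ 2 ∧ a - a ^ 2 / z = (a / z) * (z - a) ∧
      -(a ^ 2 / z) = (a / z) ^ 2 * -z := by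
    rintro z ⟨hz1, hz2⟩
    refine ⟨by linarith, by linarith, div_pos_of_neg_of_neg ha hz2, ?_, ?_, ?_⟩
    · rw [neg_div, abs_neg, ← div_pow, abs_of_nonneg (sq_nonneg _)]
    · field_simp [hz2.ne]
    · field_simp [hz2.ne]
  refine setIntegral_mono_of_nonneg measurableSet_Ioo ?_
    (fun z hz => (A2_integrand_pos hb hz).le) ?_
  · refine IntegrableOn.of_nonneg_of_le measurableSet_Ioo (by simp only [smul_eq_mul]; fun_prop)
      hi ?_ ?_
    · intro z hz
      obtain ⟨h1, h2, h3, e1, e2, e3⟩ := hcoord z hz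
      have h4 : 0 < a - a ^ 2 / z := by rw [e2]; positivity
      have h5 : 0 < -(a ^ 2 / z) := by rw [e3]; positivity
      have h6 : 0 < b - a ^ 2 / z := by linarith
      have h7 : 0 < 1 - a ^ 2 / z := by linarith
      rw [smul_eq_mul]
      positivity
    · intro z hz
      obtain ⟨h1, h2, h3, e1, e2, e3⟩ := hcoord z hz
      have h5 : 0 < -(a ^ 2 / z) := by rw [e3]; positivity
      have h6 : (b - a ^ 2 / z) ^ (-(1:ℝ)/4) ≤ (-(a ^ 2 / z)) ^ (-(1:ℝ)/4) :=
        Real.rpow_le_rpow_of_nonpos h5 (by linarith) (by norm_num)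
      have h7 : (1 - a ^ 2 / z) ^ (-(1:ℝ)/4) ≤ (-(a ^ 2 / z)) ^ (-(1:ℝ)/4) :=
        Real.rpow_le_rpow_of_nonpos h5 (by linarith) (by norm_num)
      have h8 : 0 < b - a ^ 2 / z := by linarith
      have h9 : 0 < 1 - a ^ 2 / z := by linarith
      rw [smul_eq_mul, e1, e2, zero_sub]
      set r := a / z
      have hr4 : (r ^ 2) ^ (-(1:ℝ)/4) = r ^ (-(1:ℝ)/2) := by
        rw [← Real.rpow_natCast, ← Real.rpow_mul h3.le]
        norm_num
      have hone : r ^ 2 * (r ^ (-(1:ℝ)/2) * r ^ (-(1:ℝ)/2) * r ^ (-(1:ℝ)/2) *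
          r ^ (-(1:ℝ)/2)) = 1 := by
        rw [← Real.rpow_natCast, ← Real.rpow_add h3, ← Real.rpow_add h3, ← Real.rpow_add h3,
          ← Real.rpow_add h3]
        norm_num
      have hz3 : (-z) ^ (-(3:ℝ)/4) =
          (-z) ^ (-(1:ℝ)/4) * (-z) ^ (-(1:ℝ)/4) * (-z) ^ (-(1:ℝ)/4) := by
        rw [← Real.rpow_add h2, ← Real.rpow_add h2]
        norm_num
      calc _ ≤ r ^ 2 * ((r * (z - a)) ^ (-(1:ℝ)/2) * (-(a ^ 2 / z)) ^ (-(1:ℝ)/4) *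
            (-(a ^ 2 / z)) ^ (-(1:ℝ)/4) * (-(a ^ 2 / z)) ^ (-(1:ℝ)/4)) := by gcongr
        _ = _ := by
          rw [e3, Real.mul_rpow h3.le h1.le, Real.mul_rpow (sq_nonneg r) h2.le, hr4, hz3]
          linear_combination ((z - a) ^ (-(1:ℝ)/2) * (-z) ^ (-(1:ℝ)/4) * (-z) ^ (-(1:ℝ)/4) *
            (-z) ^ (-(1:ℝ)/4)) * hone
  · intro z hz
    obtain ⟨h1, h2, h3, e1, e2, e3⟩ := hcoord z hz
    have hr : 1 < a / z := by
      rw [lt_div_iff_of_neg hz.2, one_mul]; exact hz.1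
    have hr2 : 1 < (a / z) ^ 2 := by nlinarith
    have h8 : 0 < -(a ^ 2 / z) := by rw [e3]; positivity
    have hb1 : 0 < b - a ^ 2 / z := by linarith
    have hb2 : 0 < 1 - a ^ 2 / z := by linarith
    have hb3 : 0 < b - z := by linarith
    have hb4 : 0 < 1 - z := by linarith
    have h6 : ((a / z) ^ 2 * (b - z)) ^ (-(1:ℝ)/4) ≤ (b - a ^ 2 / z) ^ (-(1:ℝ)/4) :=
      Real.rpow_le_rpow_of_nonpos hb1 (by nlinarith) (by norm_num)
    have h7 : ((a / z) ^ 2 * (1 - z)) ^ (-(1:ℝ)/4) ≤ (1 - a ^ 2 / z) ^ (-(1:ℝ)/4) :=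
      Real.rpow_le_rpow_of_nonpos hb2 (by nlinarith) (by norm_num)
    rw [smul_eq_mul, e1, e2, e3]
    set r := a / z
    have hr4 : (r ^ 2) ^ (-(1:ℝ)/4) = r ^ (-(1:ℝ)/2) := by
      rw [← Real.rpow_natCast, ← Real.rpow_mul h3.le]
      norm_num
    have hone : r ^ 2 * (r ^ (-(1:ℝ)/2) * r ^ (-(1:ℝ)/2) * r ^ (-(1:ℝ)/2) * r ^ (-(1:ℝ)/2)) = 1 := by
      rw [← Real.rpow_natCast, ← Real.rpow_add h3, ← Real.rpow_add h3, ← Real.rpow_add h3,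
        ← Real.rpow_add h3]
      norm_num
    calc _ = r ^ 2 * ((r * (z - a)) ^ (-(1:ℝ)/2) * (r ^ 2 * -z) ^ (-(1:ℝ)/4) *
          (r ^ 2 * (b - z)) ^ (-(1:ℝ)/4) * (r ^ 2 * (1 - z)) ^ (-(1:ℝ)/4)) := by
          rw [Real.mul_rpow h3.le h1.le, Real.mul_rpow (sq_nonneg r) h2.le,
            Real.mul_rpow (sq_nonneg r) hb3.le, Real.mul_rpow (sq_nonneg r) hb4.le, hr4]
          linear_combination (-((z - a) ^ (-(1:ℝ)/2) * (-z) ^ (-(1:ℝ)/4) * (b - z) ^ (-(1:ℝ)/4) *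
            (1 - z) ^ (-(1:ℝ)/4))) * hone
      _ ≤ _ := by gcongr

theorem cs4_ratio_comparison_near_zero :
    ∀ a : ℝ, a < 0 → ∃ δ : ℝ, δ ∈ Ioo (0:ℝ) 1 ∧
      ∀ b ∈ Ioo (0:ℝ) δ,
        (B1 a b + C1 a b) / A1 a b < (B2 a b + C2 a b) / A2 a b := by
  intro a ha
  obtain ⟨K, hK⟩ := exists_A2_le ha
  have hK0 : 0 < K := (hK 1 one_pos).1.trans_le (hK 1 one_pos).2
  set c : ℝ := 1 / 2 * (1 - a) ^ (-(1:ℝ)/2) with hc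
  have hc0 : 0 < c := by
    have : 0 < 1 - a := by linarith
    positivity
  set ε : ℝ := c / K / 2 with hε
  have hε0 : 0 < ε := by positivity
  obtain ⟨M₁, hM₁⟩ := exists_B1_le ha
  obtain ⟨M₂, hM₂⟩ := exists_C1_le ha hε0
  have hev : ∀ᶠ b in 𝓝[>] (0:ℝ),
      (B1 a b + C1 a b) / A1 a b < (B2 a b + C2 a b) / A2 a b := by
    filter_upwards [hM₂, Ioo_mem_nhdsGT (show (0:ℝ) < 1 / 2 by norm_num),
      (tendsto_A1_atTop ha).eventually_gt_atTop (max 0 ((M₁ + M₂) / ε))] with b hC hb hA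
    obtain ⟨hA0, hAM⟩ := max_lt_iff.1 hA
    rw [div_lt_iff₀ hε0] at hAM
    obtain ⟨hA2, hA2K⟩ := hK b hb.1
    have hC2 : c ≤ C2 a b := by
      refine le_trans ?_ (le_C2 ha hb.1 (by linarith [hb.2]))
      have : 0 < 1 - a := by linarith
      rw [hc]
      gcongr
      linarith [hb.2]
    calc (B1 a b + C1 a b) / A1 a b < 1 + c / K := by
          rw [div_lt_iff₀ hA0]
          have : c / K = 2 * ε := by rw [hε]; ring
          rw [this]
          linarith [hM₁ b hb.1]
      _ ≤ 1 + C2 a b / A2 a b := by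
          have := hc0.le.trans hC2
          gcongr
      _ = (A2 a b + C2 a b) / A2 a b := by field_simp
      _ ≤ (B2 a b + C2 a b) / A2 a b := by
          gcongr
          exact A2_le_B2 ha hb.1
  obtain ⟨δ, hδ, hsub⟩ := mem_nhdsGT_iff_exists_Ioo_subset.1 hev
  refine ⟨min δ (1 / 2), ⟨lt_min hδ (by norm_num), (min_le_right _ _).trans_lt (by norm_num)⟩,
    fun b hb => hsub ⟨hb.1, hb.2.trans_le (min_le_left _ _)⟩⟩
end

section
/- For every real b with 0 < b < 1 and every N > 0, there exists a real a < -N such that (B₁(a,b) + C₁(a,b))/A₁(a,b) > (B₂(a,b) + C₂(a,b))/A₂(a,b). (The comparison of the two period ratios for a sufficiently negative, used in constructing CS-4 surfaces converging to the Costa surface.) -/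
open MeasureTheory Set

theorem integrableOn_rpow_mul_rpow {l r p q : ℝ} (hlr : l < r) (hp : -1 < p) (hq : -1 < q) :
    IntegrableOn (fun z : ℝ => (z - l) ^ p * (r - z) ^ q) (Ioo l r) := by
  rw [← intervalIntegrable_iff_integrableOn_Ioo_of_le hlr.le]
  have hm : l ≤ (l + r) / 2 := by linarith
  have hm' : (l + r) / 2 ≤ r := by linarith
  refine IntervalIntegrable.trans (b := (l + r) / 2) ?_ ?_
  · refine IntervalIntegrable.mul_continuousOn ?_ ?_
    · simpa using (intervalIntegral.intervalIntegrable_rpow' (a := l - l)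
        (b := (l + r) / 2 - l) hp).comp_sub_right l
    · rw [uIcc_of_le hm]
      exact ContinuousOn.rpow_const (by fun_prop) fun z hz => Or.inl (by linarith [hz.2])
  · refine IntervalIntegrable.continuousOn_mul ?_ ?_
    · simpa using (intervalIntegral.intervalIntegrable_rpow' (a := r - (l + r) / 2)
        (b := r - r) hq).comp_sub_left r
    · rw [uIcc_of_le hm']
      exact ContinuousOn.rpow_const (by fun_prop) fun z hz => Or.inl (by linarith [hz.1])

theorem setIntegral_pos_of_pos_on {f : ℝ → ℝ} {s : Set ℝ} (hs : MeasurableSet s)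
    (hvol : 0 < volume s) (hf : IntegrableOn f s) (hpos : ∀ z ∈ s, 0 < f z) :
    0 < ∫ z in s, f z := by
  rw [setIntegral_pos_iff_support_of_nonneg_ae _ hf]
  · have hsub : s ⊆ Function.support f := fun z hz => (hpos z hz).ne'
    rwa [inter_eq_self_of_subset_right hsub]
  · exact (ae_restrict_iff' hs).2 (.of_forall fun z hz => (hpos z hz).le)

theorem integrableOn_of_nonneg_of_le {f g : ℝ → ℝ} {s : Set ℝ} (hs : MeasurableSet s)
    (hf : Measurable f) (hg : IntegrableOn g s) (h0 : ∀ z ∈ s, 0 ≤ f z)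
    (hle : ∀ z ∈ s, f z ≤ g z) : IntegrableOn f s := by
  refine Integrable.mono' hg hf.aestronglyMeasurable ?_
  refine (ae_restrict_iff' hs).2 (.of_forall fun z hz => ?_)
  rw [Real.norm_of_nonneg (h0 z hz)]
  exact hle z hz

theorem setIntegral_le_of_nonneg_of_le {f g : ℝ → ℝ} {s : Set ℝ} (hs : MeasurableSet s)
    (hg : IntegrableOn g s) (h0 : ∀ z ∈ s, 0 ≤ f z) (hle : ∀ z ∈ s, f z ≤ g z) :
    ∫ z in s, f z ≤ ∫ z in s, g z :=
  integral_mono_of_nonneg ((ae_restrict_iff' hs).2 (.of_forall h0)) hg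
    ((ae_restrict_iff' hs).2 (.of_forall hle))

/-- The common part of the integrands of `A1` and `B1`, independent of `a`. -/
noncomputable def negWeight (b z : ℝ) : ℝ :=
  (-z) ^ (-(3:ℝ)/4) * (b - z) ^ (-(3:ℝ)/4) * (1 - z) ^ (-(3:ℝ)/4)

/-- The part of the integrand of `C1` that is independent of `a`. -/
noncomputable def midWeight (b z : ℝ) : ℝ :=
  z ^ (-(3:ℝ)/4) * (z - b) ^ (-(3:ℝ)/4) * (1 - z) ^ (-(3:ℝ)/4)

theorem measurable_negWeight (b : ℝ) : Measurable (negWeight b) := by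
  unfold negWeight; fun_prop

theorem measurable_midWeight (b : ℝ) : Measurable (midWeight b) := by
  unfold midWeight; fun_prop

theorem negWeight_pos {b z : ℝ} (hb : 0 < b) (hz : z < 0) : 0 < negWeight b z := by
  have h1 : 0 < -z := by linarith
  have h2 : 0 < b - z := by linarith
  have h3 : 0 < 1 - z := by linarith
  unfold negWeight; positivity

theorem midWeight_pos {b z : ℝ} (hb : 0 < b) (hz : z ∈ Ioo b 1) : 0 < midWeight b z := by
  have h1 : 0 < z := hb.trans hz.1
  have h2 : 0 < z - b := by linarith [hz.1]
  have h3 : 0 < 1 - z := by linarith [hz.2]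
  unfold midWeight; positivity

theorem integrableOn_midWeight {b : ℝ} (hb : 0 < b) (hb1 : b < 1) :
    IntegrableOn (midWeight b) (Ioo b 1) := by
  refine integrableOn_of_nonneg_of_le measurableSet_Ioo (measurable_midWeight b)
    ((integrableOn_rpow_mul_rpow hb1 (p := -(3:ℝ)/4) (q := -(3:ℝ)/4) (by norm_num)
      (by norm_num)).const_mul (b ^ (-(3:ℝ)/4)))
    (fun z hz => (midWeight_pos hb hz).le) fun z hz => ?_
  have h2 : 0 < z - b := by linarith [hz.1]
  have h3 : 0 < 1 - z := by linarith [hz.2]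
  have h4 : z ^ (-(3:ℝ)/4) ≤ b ^ (-(3:ℝ)/4) :=
    Real.rpow_le_rpow_of_nonpos hb hz.1.le (by norm_num)
  unfold midWeight
  rw [mul_assoc]
  gcongr

/-- The Möbius map exchanging `∞ ↔ 1` and `0 ↔ b` sends the negative half-line to `(b, 1)`. -/
theorem image_moebius_Iio {b : ℝ} (hb : 0 < b) (hb1 : b < 1) :
    (fun z : ℝ => (b - z) / (1 - z)) '' Iio 0 = Ioo b 1 := by
  ext y
  constructor
  · rintro ⟨z, hz, rfl⟩
    have hz : z < 0 := hz
    have h3 : 0 < 1 - z := by linarith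
    constructor
    · rw [lt_div_iff₀ h3]; nlinarith
    · rw [div_lt_one h3]; linarith
  · rintro ⟨h1, h2⟩
    have h3 : 0 < 1 - y := by linarith
    refine ⟨(b - y) / (1 - y), div_neg_of_neg_of_pos (by linarith) h3, ?_⟩
    have h4 : 1 - (b - y) / (1 - y) = (1 - b) / (1 - y) := by field_simp; ring
    have h5 : 0 < 1 - b := by linarith
    simp only [h4]
    field_simp
    ring

theorem injOn_moebius_Iio {b : ℝ} (hb1 : b < 1) :
    InjOn (fun z : ℝ => (b - z) / (1 - z)) (Iio 0) := by
  intro x hx y hy hxy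
  have hx : x < 0 := hx
  have hy : y < 0 := hy
  have h1 : 1 - x ≠ 0 := by linarith
  have h2 : 1 - y ≠ 0 := by linarith
  simp only at hxy
  rw [div_eq_div_iff h1 h2] at hxy
  have h3 : (1 - b) * (x - y) = 0 := by linear_combination -hxy
  rcases mul_eq_zero.1 h3 with h | h <;> linarith

theorem hasDerivAt_moebius {b z : ℝ} (hz : z < 0) :
    HasDerivAt (fun z : ℝ => (b - z) / (1 - z)) (-((1 - b) / (1 - z) ^ 2)) z := by
  have h1 : 1 - z ≠ 0 := by linarith
  refine (((hasDerivAt_id z).const_sub b).div ((hasDerivAt_id z).const_sub 1) h1).congr_deriv ?_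
  rw [← neg_div]
  congr 1
  simp only [id]
  ring

theorem rpow_neg_three_fourths_pow_four {x : ℝ} (hx : 0 < x) :
    (x ^ (-(3:ℝ)/4)) ^ 4 * x ^ 3 = 1 := by
  rw [← Real.rpow_natCast, ← Real.rpow_mul hx.le, ← Real.rpow_natCast, ← Real.rpow_add hx]
  norm_num

theorem midWeight_moebius {b z : ℝ} (hb : 0 < b) (hb1 : b < 1) (hz : z < 0) :
    |-((1 - b) / (1 - z) ^ 2)| • midWeight b ((b - z) / (1 - z)) =
      (1 - b) ^ (-(1:ℝ)/2) * (1 - z) * negWeight b z := by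
  have h0 : 0 < 1 - b := by linarith
  have h1 : 0 < -z := by linarith
  have h2 : 0 < b - z := by linarith
  have h3 : 0 < 1 - z := by linarith
  have e1 : (b - z) / (1 - z) - b = (-z) * (1 - b) / (1 - z) := by field_simp; ring
  have e2 : 1 - (b - z) / (1 - z) = (1 - b) / (1 - z) := by field_simp; ring
  have e3 : (1 - b) ^ (-(1:ℝ)/2) =
      (1 - b) * (1 - b) ^ (-(3:ℝ)/4) * (1 - b) ^ (-(3:ℝ)/4) := by
    nth_rewrite 2 [← Real.rpow_one (1 - b)]
    rw [← Real.rpow_add h0, ← Real.rpow_add h0]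
    norm_num
  rw [abs_neg, abs_of_pos (by positivity), smul_eq_mul, midWeight, negWeight, e1, e2, e3,
    Real.div_rpow h2.le h3.le, Real.div_rpow (by positivity) h3.le,
    Real.mul_rpow h1.le h0.le, Real.div_rpow h0.le h3.le]
  have hD := rpow_neg_three_fourths_pow_four h3
  have hDpos : 0 < (1 - z) ^ (-(3:ℝ)/4) := by positivity
  set D := (1 - z) ^ (-(3:ℝ)/4)
  field_simp
  linear_combination (-1 : ℝ) * hD

theorem integrableOn_smul_negWeight {b : ℝ} (hb : 0 < b) (hb1 : b < 1) :
    IntegrableOn (fun z => (1 - b) ^ (-(1:ℝ)/2) * (1 - z) * negWeight b z) (Iio 0) := by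
  have h := integrableOn_midWeight hb hb1
  rw [← image_moebius_Iio hb hb1, integrableOn_image_iff_integrableOn_abs_deriv_smul
    measurableSet_Iio (fun z hz => (hasDerivAt_moebius hz).hasDerivWithinAt)
    (injOn_moebius_Iio hb1)] at h
  exact h.congr_fun (fun z hz => midWeight_moebius hb hb1 hz) measurableSet_Iio

theorem setIntegral_midWeight {b : ℝ} (hb : 0 < b) (hb1 : b < 1) :
    ∫ z in Ioo b 1, midWeight b z =
      ∫ z in Iio 0, (1 - b) ^ (-(1:ℝ)/2) * (1 - z) * negWeight b z := by
  rw [← image_moebius_Iio hb hb1, integral_image_eq_integral_abs_deriv_smul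
    measurableSet_Iio (fun z hz => (hasDerivAt_moebius hz).hasDerivWithinAt)
    (injOn_moebius_Iio hb1)]
  exact setIntegral_congr_fun measurableSet_Iio fun z hz => midWeight_moebius hb hb1 hz

theorem negWeight_lt {b z : ℝ} (hb : 0 < b) (hb1 : b < 1) (hz : z < 0) :
    negWeight b z < (1 - b) ^ (-(1:ℝ)/2) * (1 - z) * negWeight b z := by
  have h1 : 1 < (1 - b) ^ (-(1:ℝ)/2) :=
    Real.one_lt_rpow_of_pos_of_lt_one_of_neg (by linarith) (by linarith) (by norm_num)
  have h2 : 1 < 1 - z := by linarith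
  exact lt_mul_of_one_lt_left (negWeight_pos hb hz) (one_lt_mul_of_lt_of_le h1 h2.le)

theorem integrableOn_negWeight {b : ℝ} (hb : 0 < b) (hb1 : b < 1) :
    IntegrableOn (negWeight b) (Iio 0) :=
  integrableOn_of_nonneg_of_le measurableSet_Iio (measurable_negWeight b)
    (integrableOn_smul_negWeight hb hb1) (fun _ hz => (negWeight_pos hb hz).le)
    fun _ hz => (negWeight_lt hb hb1 hz).le

theorem setIntegral_negWeight_pos {b : ℝ} (hb : 0 < b) (hb1 : b < 1) :
    0 < ∫ z in Iio 0, negWeight b z :=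
  setIntegral_pos_of_pos_on measurableSet_Iio (by simp) (integrableOn_negWeight hb hb1)
    fun _ hz => negWeight_pos hb hz

theorem setIntegral_negWeight_lt {b : ℝ} (hb : 0 < b) (hb1 : b < 1) :
    ∫ z in Iio 0, negWeight b z < ∫ z in Ioo b 1, midWeight b z := by
  have h1 := integrableOn_smul_negWeight hb hb1
  have h2 := integrableOn_negWeight hb hb1
  rw [setIntegral_midWeight hb hb1, ← sub_pos, ← integral_sub h1 h2]
  exact setIntegral_pos_of_pos_on measurableSet_Iio (by simp) (h1.sub h2)
    fun z hz => sub_pos.2 (negWeight_lt hb hb1 hz)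

theorem A1_eq (a b : ℝ) : A1 a b = ∫ z in Ioo a 0, (z - a) ^ ((1:ℝ)/2) * negWeight b z := by
  simp only [A1, negWeight, mul_assoc]

theorem C1_eq (a b : ℝ) : C1 a b = ∫ z in Ioo b 1, (z - a) ^ ((1:ℝ)/2) * midWeight b z := by
  simp only [C1, midWeight, mul_assoc]

theorem A1_integrand_le {a b z : ℝ} (hb : 0 < b) (hz : z ∈ Ioo a 0) :
    (z - a) ^ ((1:ℝ)/2) * negWeight b z ≤ (-a) ^ ((1:ℝ)/2) * negWeight b z := by
  have h1 : 0 ≤ z - a := by linarith [hz.1]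
  have h2 := (negWeight_pos hb hz.2).le
  gcongr
  linarith [hz.2]

theorem A1_integrand_pos {a b z : ℝ} (hb : 0 < b) (hz : z ∈ Ioo a 0) :
    0 < (z - a) ^ ((1:ℝ)/2) * negWeight b z := by
  have h1 : 0 < z - a := by linarith [hz.1]
  have h2 := negWeight_pos hb hz.2
  positivity

theorem A1_pos {a b : ℝ} (ha : a < 0) (hb : 0 < b) (hb1 : b < 1) : 0 < A1 a b := by
  rw [A1_eq]
  refine setIntegral_pos_of_pos_on measurableSet_Ioo (by simpa using ha) ?_
    fun z hz => A1_integrand_pos hb hz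
  exact integrableOn_of_nonneg_of_le measurableSet_Ioo
    (Measurable.mul (by fun_prop) (measurable_negWeight b))
    (((integrableOn_negWeight hb hb1).mono_set Ioo_subset_Iio_self).const_mul
      ((-a) ^ ((1:ℝ)/2)))
    (fun z hz => (A1_integrand_pos hb hz).le) fun z hz => A1_integrand_le hb hz

theorem A1_le {a b : ℝ} (ha : a < 0) (hb : 0 < b) (hb1 : b < 1) :
    A1 a b ≤ (-a) ^ ((1:ℝ)/2) * ∫ z in Iio 0, negWeight b z := by
  have ha' : 0 < -a := by linarith
  have hint : IntegrableOn (fun z => (-a) ^ ((1:ℝ)/2) * negWeight b z) (Iio 0) :=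
    (integrableOn_negWeight hb hb1).const_mul _
  rw [A1_eq, ← integral_const_mul]
  refine (setIntegral_le_of_nonneg_of_le measurableSet_Ioo (hint.mono_set Ioo_subset_Iio_self)
    (fun z hz => (A1_integrand_pos hb hz).le) fun z hz => A1_integrand_le hb hz).trans ?_
  refine setIntegral_mono_set hint ?_ (Ioo_subset_Iio_self.eventuallyLE)
  refine (ae_restrict_iff' measurableSet_Iio).2 (.of_forall fun z hz => ?_)
  have := negWeight_pos hb hz
  simp only [Pi.zero_apply]
  positivity

theorem le_C1 {a b : ℝ} (ha : a < 0) (hb : 0 < b) (hb1 : b < 1) :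
    (-a) ^ ((1:ℝ)/2) * ∫ z in Ioo b 1, midWeight b z ≤ C1 a b := by
  have ha' : 0 < -a := by linarith
  rw [C1_eq, ← integral_const_mul]
  refine setIntegral_le_of_nonneg_of_le measurableSet_Ioo ?_ (fun z hz => ?_) fun z hz => ?_
  · refine integrableOn_of_nonneg_of_le measurableSet_Ioo
      (Measurable.mul (by fun_prop) (measurable_midWeight b))
      ((integrableOn_midWeight hb hb1).const_mul ((1 - a) ^ ((1:ℝ)/2)))
      (fun z hz => ?_) fun z hz => ?_
    · have h1 : 0 < z - a := by linarith [hz.1]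
      have h2 := midWeight_pos hb hz
      positivity
    · have h1 : 0 < z - a := by linarith [hz.1]
      have h2 := (midWeight_pos hb hz).le
      gcongr
      exact hz.2.le
  · have h2 := midWeight_pos hb hz
    positivity
  · have h2 := (midWeight_pos hb hz).le
    gcongr
    linarith [hz.1]

theorem B1_nonneg {a b : ℝ} (ha : a < 0) (hb : 0 < b) : 0 ≤ B1 a b := by
  refine setIntegral_nonneg measurableSet_Iio fun z hz => ?_
  have hz : z < a := hz
  have h0 : 0 < a - z := by linarith
  have h1 : 0 < -z := by linarith
  have h2 : 0 < b - z := by linarith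
  have h3 : 0 < 1 - z := by linarith
  positivity

theorem le_first_ratio {a b : ℝ} (ha : a < 0) (hb : 0 < b) (hb1 : b < 1) :
    (∫ z in Ioo b 1, midWeight b z) / (∫ z in Iio 0, negWeight b z) ≤
      (B1 a b + C1 a b) / A1 a b := by
  have hK := setIntegral_negWeight_pos hb hb1
  have hL := hK.trans (setIntegral_negWeight_lt hb hb1)
  rw [div_le_div_iff₀ hK (A1_pos ha hb hb1)]
  calc _ ≤ (∫ z in Ioo b 1, midWeight b z) *
        ((-a) ^ ((1:ℝ)/2) * ∫ z in Iio 0, negWeight b z) := by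
        gcongr; exact A1_le ha hb hb1
    _ = ((-a) ^ ((1:ℝ)/2) * ∫ z in Ioo b 1, midWeight b z) *
        ∫ z in Iio 0, negWeight b z := by ring
    _ ≤ _ := by
        gcongr
        linarith [le_C1 ha hb hb1, B1_nonneg ha hb]

/-- The rescaled limit, as `a → -∞`, of the integrands of `A2` and `B2`. -/
noncomputable def limitWeight (u : ℝ) : ℝ :=
  (1 - u) ^ (-(1:ℝ)/2) * u ^ (-(1:ℝ)/4) * u ^ (-(1:ℝ)/4) * u ^ (-(1:ℝ)/4)

theorem integrableOn_limitWeight : IntegrableOn limitWeight (Ioo 0 1) := by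
  refine (integrableOn_rpow_mul_rpow zero_lt_one (p := -(3:ℝ)/4) (q := -(1:ℝ)/2) (by norm_num)
      (by norm_num)).congr_fun (fun u hu => ?_) measurableSet_Ioo
  have e : u ^ (-(3:ℝ)/4) = u ^ (-(1:ℝ)/4) * u ^ (-(1:ℝ)/4) * u ^ (-(1:ℝ)/4) := by
    rw [← Real.rpow_add hu.1, ← Real.rpow_add hu.1]
    norm_num
  simp only [limitWeight, sub_zero, e]
  ring

theorem setIntegral_limitWeight_pos : 0 < ∫ u in Ioo 0 1, limitWeight u := by
  refine setIntegral_pos_of_pos_on measurableSet_Ioo (by simp) integrableOn_limitWeight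
    fun u hu => ?_
  have h0 : 0 < u := hu.1
  have h1 : 0 < 1 - u := by linarith [hu.2]
  unfold limitWeight
  positivity

theorem pow_four_rpow_neg_fourth {m : ℝ} (hm : 0 < m) : (m ^ 4) ^ (-(1:ℝ)/4) = m⁻¹ := by
  rw [← Real.rpow_natCast, ← Real.rpow_mul hm.le, ← Real.rpow_neg_one]
  norm_num

theorem pow_four_rpow_neg_half {m : ℝ} (hm : 0 < m) : (m ^ 4) ^ (-(1:ℝ)/2) = (m ^ 2)⁻¹ := by
  rw [← Real.rpow_natCast, ← Real.rpow_mul hm.le, ← Real.rpow_natCast, ← Real.rpow_neg hm.le]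
  norm_num

theorem mul_A2_eq {m b : ℝ} (hm : 0 < m) (hb : 0 < b) :
    m * A2 (-m ^ 4) b = ∫ u in Ioo 0 1, (1 - u) ^ (-(1:ℝ)/2) * u ^ (-(1:ℝ)/4) *
      (b / m ^ 4 + u) ^ (-(1:ℝ)/4) * (1 / m ^ 4 + u) ^ (-(1:ℝ)/4) := by
  have hm4 : 0 < m ^ 4 := by positivity
  have himg : (fun u : ℝ => -m ^ 4 * u) '' Ioo 0 1 = Ioo (-m ^ 4) 0 := by
    ext y
    constructor
    · rintro ⟨u, ⟨h0, h1⟩, rfl⟩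
      constructor <;> nlinarith
    · rintro ⟨h0, h1⟩
      refine ⟨-y / m ^ 4, ⟨div_pos (by linarith) hm4, ?_⟩, by field_simp⟩
      rw [div_lt_one hm4]; linarith
  rw [A2, ← himg, integral_image_eq_integral_abs_deriv_smul (f' := fun _ => -m ^ 4)
    measurableSet_Ioo (fun u _ => by simpa using
      ((hasDerivAt_id u).const_mul (-m ^ 4)).hasDerivWithinAt)
    (fun x _ y _ h => by simpa [hm.ne'] using h), ← integral_const_mul]
  refine setIntegral_congr_fun measurableSet_Ioo fun u hu => ?_
  have h0 : 0 < u := hu.1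
  have h1 : 0 < 1 - u := by linarith [hu.2]
  have e1 : -m ^ 4 * u - -m ^ 4 = m ^ 4 * (1 - u) := by ring
  have e2 : -(-m ^ 4 * u) = m ^ 4 * u := by ring
  have e3 : b - -m ^ 4 * u = m ^ 4 * (b / m ^ 4 + u) := by field_simp; ring
  have e4 : 1 - -m ^ 4 * u = m ^ 4 * (1 / m ^ 4 + u) := by field_simp; ring
  simp only [abs_neg, abs_of_pos hm4, smul_eq_mul]
  rw [e1, e2, e3, e4, Real.mul_rpow hm4.le h1.le, Real.mul_rpow hm4.le h0.le,
    Real.mul_rpow hm4.le (by positivity), Real.mul_rpow hm4.le (by positivity),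
    pow_four_rpow_neg_fourth hm, pow_four_rpow_neg_half hm]
  field_simp

theorem tendsto_mul_A2 {b : ℝ} (hb : 0 < b) :
    Filter.Tendsto (fun m : ℝ => m * A2 (-m ^ 4) b) Filter.atTop
      (nhds (∫ u in Ioo 0 1, limitWeight u)) := by
  refine Filter.Tendsto.congr' ((Filter.eventually_gt_atTop 0).mono fun m hm =>
    (mul_A2_eq hm hb).symm) ?_
  refine tendsto_integral_filter_of_dominated_convergence limitWeight
    (.of_forall fun m => Measurable.aestronglyMeasurable (by fun_prop)) ?_
    integrableOn_limitWeight ?_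
  · filter_upwards [Filter.eventually_gt_atTop 0] with m hm
    refine (ae_restrict_iff' measurableSet_Ioo).2 (.of_forall fun u hu => ?_)
    have h0 : 0 < u := hu.1
    have h1 : 0 < 1 - u := by linarith [hu.2]
    have hc : ∀ c : ℝ, 0 < c → (c / m ^ 4 + u) ^ (-(1:ℝ)/4) ≤ u ^ (-(1:ℝ)/4) := fun c hc =>
      Real.rpow_le_rpow_of_nonpos h0 (le_add_of_nonneg_left (by positivity)) (by norm_num)
    rw [Real.norm_of_nonneg (by positivity), limitWeight]
    have hcb := hc b hb
    have hc1 := hc 1 one_pos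
    gcongr
  · refine (ae_restrict_iff' measurableSet_Ioo).2 (.of_forall fun u hu => ?_)
    have h0 : 0 < u := hu.1
    have hc : ∀ c : ℝ, Filter.Tendsto (fun m : ℝ => (c / m ^ 4 + u) ^ (-(1:ℝ)/4)) Filter.atTop
        (nhds (u ^ (-(1:ℝ)/4))) := fun c => by
      refine Filter.Tendsto.rpow_const ?_ (Or.inl h0.ne')
      simpa using ((Filter.tendsto_pow_atTop (α := ℝ) (n := 4) (by norm_num)).const_div_atTop
        c).add_const u
    exact ((tendsto_const_nhds).mul (hc b)).mul (hc 1)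

theorem mul_B2_le {m b : ℝ} (hm : 0 < m) (hb : 0 < b) :
    m * B2 (-m ^ 4) b ≤ ∫ u in Ioo 0 1, limitWeight u := by
  have hm4 : 0 < m ^ 4 := by positivity
  have himg : (fun u : ℝ => -m ^ 4 * u⁻¹) '' Ioo 0 1 = Iio (-m ^ 4) := by
    ext y
    constructor
    · rintro ⟨u, ⟨h0, h1⟩, rfl⟩
      have := (one_lt_inv₀ h0).2 h1
      simp only [mem_Iio]
      nlinarith
    · intro hy
      have hy : y < -m ^ 4 := hy
      have hy0 : 0 < -y := by linarith
      refine ⟨m ^ 4 / -y, ⟨by positivity, (div_lt_one hy0).2 (by linarith)⟩, ?_⟩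
      simp only [inv_div]
      field_simp
  rw [B2, ← himg, integral_image_eq_integral_abs_deriv_smul
    (f' := fun u => -m ^ 4 * (-(u ^ 2)⁻¹)) measurableSet_Ioo
    (fun u hu => ((hasDerivAt_inv hu.1.ne').const_mul (-m ^ 4)).hasDerivWithinAt)
    (fun x _ y _ h => by simpa [hm.ne'] using h), ← integral_const_mul]
  refine setIntegral_le_of_nonneg_of_le measurableSet_Ioo integrableOn_limitWeight
    (fun u hu => ?_) fun u hu => ?_
  all_goals
    have h0 : 0 < u := hu.1
    have h1 : 0 < 1 - u := by linarith [hu.2]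
    have e1 : -m ^ 4 - -m ^ 4 * u⁻¹ = m ^ 4 * ((1 - u) / u) := by field_simp; ring
    have e2 : -(-m ^ 4 * u⁻¹) = m ^ 4 / u := by field_simp
    have e3 : ∀ c : ℝ, c - -m ^ 4 * u⁻¹ = c + m ^ 4 / u := fun c => by field_simp; ring
    have e4 : -m ^ 4 * (-(u ^ 2)⁻¹) = m ^ 4 / u ^ 2 := by field_simp
    simp only [smul_eq_mul]
    rw [e1, e2, e3, e3, e4, abs_of_pos (by positivity)]
  · positivity
  · have hc : ∀ c : ℝ, 0 < c → (c + m ^ 4 / u) ^ (-(1:ℝ)/4) ≤ (m ^ 4 / u) ^ (-(1:ℝ)/4) :=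
      fun c hc => Real.rpow_le_rpow_of_nonpos (by positivity)
        (le_add_of_nonneg_left hc.le) (by norm_num)
    calc _ ≤ m * (m ^ 4 / u ^ 2 * ((m ^ 4 * ((1 - u) / u)) ^ (-(1:ℝ)/2) *
          (m ^ 4 / u) ^ (-(1:ℝ)/4) * (m ^ 4 / u) ^ (-(1:ℝ)/4) * (m ^ 4 / u) ^ (-(1:ℝ)/4))) := by
          have hcb := hc b hb
          have hc1 := hc 1 one_pos
          gcongr
      _ = limitWeight u := by
          obtain ⟨v, hv, rfl⟩ : ∃ v : ℝ, 0 < v ∧ v ^ 4 = u :=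
            ⟨u ^ ((1:ℝ)/4), by positivity, by
              rw [← Real.rpow_natCast, ← Real.rpow_mul h0.le]; norm_num⟩
          rw [limitWeight, Real.mul_rpow hm4.le (by positivity), Real.div_rpow h1.le h0.le,
            Real.div_rpow hm4.le h0.le, pow_four_rpow_neg_fourth hm, pow_four_rpow_neg_half hm,
            pow_four_rpow_neg_fourth hv, pow_four_rpow_neg_half hv]
          field_simp

theorem mul_C2_le {m b : ℝ} (hm : 0 < m) (hb : 0 < b) (hb1 : b < 1) :
    m * C2 (-m ^ 4) b ≤ (b ^ (-(1:ℝ)/4) *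
      ∫ z in Ioo b 1, (z - b) ^ (-(1:ℝ)/4) * (1 - z) ^ (-(1:ℝ)/4)) / m := by
  have hm4 : 0 < m ^ 4 := by positivity
  have hle : C2 (-m ^ 4) b ≤ ∫ z in Ioo b 1, (m ^ 2)⁻¹ * (b ^ (-(1:ℝ)/4) *
      ((z - b) ^ (-(1:ℝ)/4) * (1 - z) ^ (-(1:ℝ)/4))) := by
    refine setIntegral_le_of_nonneg_of_le measurableSet_Ioo
      (((integrableOn_rpow_mul_rpow hb1 (by norm_num) (by norm_num)).const_mul _).const_mul _)
      (fun z hz => ?_) fun z hz => ?_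
    all_goals
      have h0 : 0 < z := hb.trans hz.1
      have h1 : 0 < z - b := by linarith [hz.1]
      have h2 : 0 < 1 - z := by linarith [hz.2]
      have h3 : m ^ 4 ≤ z - -m ^ 4 := by linarith
      have h4 : 0 < z - -m ^ 4 := hm4.trans_le h3
    · positivity
    · have h5 : (z - -m ^ 4) ^ (-(1:ℝ)/2) ≤ (m ^ 2)⁻¹ := by
        rw [← pow_four_rpow_neg_half hm]
        exact Real.rpow_le_rpow_of_nonpos hm4 h3 (by norm_num)
      have h6 : z ^ (-(1:ℝ)/4) ≤ b ^ (-(1:ℝ)/4) :=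
        Real.rpow_le_rpow_of_nonpos hb hz.1.le (by norm_num)
      rw [mul_assoc, mul_assoc]
      gcongr
  rw [integral_const_mul, integral_const_mul] at hle
  calc m * C2 (-m ^ 4) b ≤ m * ((m ^ 2)⁻¹ * (b ^ (-(1:ℝ)/4) *
      ∫ z in Ioo b 1, (z - b) ^ (-(1:ℝ)/4) * (1 - z) ^ (-(1:ℝ)/4))) := by gcongr
    _ = _ := by field_simp

theorem eventually_second_ratio_lt {b r : ℝ} (hb : 0 < b) (hb1 : b < 1) (hr : 1 < r) :
    ∀ᶠ m : ℝ in Filter.atTop,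
      (B2 (-m ^ 4) b + C2 (-m ^ 4) b) / A2 (-m ^ 4) b < r := by
  have hβ := setIntegral_limitWeight_pos
  set β := ∫ u in Ioo 0 1, limitWeight u with hβdef
  set c := b ^ (-(1:ℝ)/4) * ∫ z in Ioo b 1, (z - b) ^ (-(1:ℝ)/4) * (1 - z) ^ (-(1:ℝ)/4)
    with hc
  have hA : Filter.Tendsto (fun m : ℝ => m * A2 (-m ^ 4) b) Filter.atTop (nhds β) :=
    tendsto_mul_A2 hb
  have hlim : Filter.Tendsto (fun m : ℝ => r * (m * A2 (-m ^ 4) b) - (β + c / m))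
      Filter.atTop (nhds (r * β - (β + 0))) :=
    (hA.const_mul r).sub (tendsto_const_nhds.add (Filter.tendsto_id.const_div_atTop c))
  have hpos : 0 < r * β - (β + 0) := by nlinarith
  filter_upwards [hlim.eventually_const_lt hpos, hA.eventually_const_lt hβ,
    Filter.eventually_gt_atTop 0] with m h1 h2 hm
  have hA2 : 0 < A2 (-m ^ 4) b := pos_of_mul_pos_right h2 hm.le
  rw [div_lt_iff₀ hA2]
  refine lt_of_mul_lt_mul_left ?_ hm.le
  have h3 := mul_B2_le hm hb
  have h4 := mul_C2_le hm hb hb1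
  rw [← hβdef] at h3
  rw [← hc] at h4
  linarith

theorem cs4_ratio_comparison_a_negative :
    ∀ b : ℝ, 0 < b → b < 1 → ∀ N : ℝ, 0 < N →
      ∃ a : ℝ, a < -N ∧
        (B1 a b + C1 a b) / A1 a b > (B2 a b + C2 a b) / A2 a b := by
  intro b hb hb1 N hN
  have hr := (one_lt_div (setIntegral_negWeight_pos hb hb1)).2 (setIntegral_negWeight_lt hb hb1)
  obtain ⟨m, h1, h2, hm⟩ := ((eventually_second_ratio_lt hb hb1 hr).and
    (((Filter.tendsto_pow_atTop (α := ℝ) (n := 4) (by norm_num)).eventually_gt_atTop N).and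
      (Filter.eventually_gt_atTop 0))).exists
  exact ⟨-m ^ 4, neg_lt_neg h2, h1.trans_le (le_first_ratio (by linarith) hb hb1)⟩
end

section
/- For each fixed real b with 0 < b < 1 there exist constants C > 0 and M > 0 such that for all a < -M: (1/C)·(-a)^{1/2} ≤ A₁(a,b) ≤ C·(-a)^{1/2}, (1/C)·(-a)^{1/2} ≤ C₁(a,b) ≤ C·(-a)^{1/2}, (1/C)·(-a)^{1/2} ≤ D₁(a,b) ≤ C·(-a)^{1/2}, and (1/C)·(-a)^{-3/4} ≤ B₁(a,b) ≤ C·(-a)^{-3/4}. (Asymptotic orders of the φ₁-period integrals as a → -∞.) -/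
open MeasureTheory Set

/-- D₁(a,b) = (1/√2)·∫_1^∞ (z-a)^{1/2} z^{-3/4}(z-b)^{-3/4}(z-1)^{-3/4} dz -/
noncomputable def D1 (a b : ℝ) : ℝ :=
  (1 / Real.sqrt 2) *
    ∫ z in Ioi (1:ℝ), (z - a) ^ ((1:ℝ)/2) * z ^ (-(3:ℝ)/4) * (z - b) ^ (-(3:ℝ)/4) * (z - 1) ^ (-(3:ℝ)/4)

theorem setIntegral_two_sided {f G : ℝ → ℝ} {S U : Set ℝ} {c k p q : ℝ} (hpq : p ≤ q)
    (hpS : Ioo p q ⊆ S) (hSU : S ⊆ U) (hS : MeasurableSet S) (hU : MeasurableSet U)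
    (hf : ContinuousOn f S) (hf0 : ∀ z ∈ S, 0 ≤ f z) (hG0 : ∀ z ∈ U, 0 ≤ G z)
    (hG : IntegrableOn G U) (hk : 0 ≤ k) (hcf : ∀ z ∈ Ioo p q, c ≤ f z)
    (hfG : ∀ z ∈ S, f z ≤ k * G z) :
    c * (q - p) ≤ ∫ z in S, f z ∧ ∫ z in S, f z ≤ k * ∫ z in U, G z := by
  have hGk : IntegrableOn (fun z => k * G z) U := Integrable.const_mul hG k
  have hfi : IntegrableOn f S := by
    refine Integrable.mono' (hGk.mono_set hSU) (hf.aestronglyMeasurable hS) ?_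
    refine (ae_restrict_iff' hS).2 (.of_forall fun z hz => ?_)
    rw [Real.norm_of_nonneg (hf0 z hz)]
    exact hfG z hz
  constructor
  · calc c * (q - p) = ∫ _ in Ioo p q, c := by
          rw [setIntegral_const, Real.volume_real_Ioo_of_le hpq, smul_eq_mul, mul_comm]
      _ ≤ ∫ z in Ioo p q, f z :=
          setIntegral_mono_on (integrableOn_const (by simp)) (hfi.mono_set hpS)
            measurableSet_Ioo hcf
      _ ≤ ∫ z in S, f z :=
          setIntegral_mono_set hfi ((ae_restrict_iff' hS).2 (.of_forall hf0))
            (Filter.Eventually.of_forall hpS)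
  · calc ∫ z in S, f z ≤ ∫ z in S, k * G z :=
          setIntegral_mono_on hfi (hGk.mono_set hSU) hS hfG
      _ ≤ ∫ z in U, k * G z :=
          setIntegral_mono_set hGk
            ((ae_restrict_iff' hU).2 (.of_forall fun z hz => mul_nonneg hk (hG0 z hz)))
            (Filter.Eventually.of_forall hSU)
      _ = k * ∫ z in U, G z := integral_const_mul _ _

theorem exists_forall_ge_two_sided {F h : ℝ → ℝ} {c K : ℝ} (hc : 0 < c)
    (hh : ∀ a < -1, 0 ≤ h a) (H : ∀ a < -1, c * h a ≤ F a ∧ F a ≤ K * h a) :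
    ∃ C₀, ∀ C ≥ C₀, ∀ a < -1, 1 / C * h a ≤ F a ∧ F a ≤ C * h a := by
  refine ⟨max (1 / c) K, fun C hC a ha => ⟨?_, ?_⟩⟩
  · refine le_trans (mul_le_mul_of_nonneg_right ?_ (hh a ha)) (H a ha).1
    exact (one_div_le ((one_div_pos.2 hc).trans_le ((le_max_left _ _).trans hC)) hc).2
      ((le_max_left _ _).trans hC)
  · exact (H a ha).2.trans
      (mul_le_mul_of_nonneg_right ((le_max_right _ _).trans hC) (hh a ha))

theorem integrableOn_rpow_mul_add_one_inv :
    IntegrableOn (fun y : ℝ => y ^ (-(3:ℝ)/4) * (y + 1)⁻¹) (Ioi 0) := by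
  have hcont : ContinuousOn (fun y : ℝ => y ^ (-(3:ℝ)/4) * (y + 1)⁻¹) (Ioi 0) := by
    refine ContinuousOn.mul
      (continuousOn_id.rpow_const fun y hy => Or.inl (ne_of_gt hy)) ?_
    exact ContinuousOn.inv₀ (by fun_prop) fun y (hy : 0 < y) => by positivity
  rw [← Ioc_union_Ioi_eq_Ioi zero_le_one]
  refine IntegrableOn.union ?_ ?_
  · have h : IntegrableOn (fun y : ℝ => y ^ (-(3:ℝ)/4)) (Ioc 0 1) :=
      (intervalIntegrable_iff_integrableOn_Ioc_of_le zero_le_one).1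
        (intervalIntegral.intervalIntegrable_rpow' (by norm_num))
    refine Integrable.mono' h
      ((hcont.mono Ioc_subset_Ioi_self).aestronglyMeasurable measurableSet_Ioc) ?_
    refine (ae_restrict_iff' measurableSet_Ioc).2 (.of_forall fun y hy => ?_)
    have hy0 : 0 < y := hy.1
    rw [Real.norm_of_nonneg (by positivity)]
    exact mul_le_of_le_one_right (by positivity) (inv_le_one_of_one_le₀ (by linarith))
  · have h : IntegrableOn (fun y : ℝ => y ^ (-(7:ℝ)/4)) (Ioi 1) :=
      integrableOn_Ioi_rpow_of_lt (by norm_num) one_pos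
    refine Integrable.mono' h
      ((hcont.mono (Ioi_subset_Ioi zero_le_one)).aestronglyMeasurable measurableSet_Ioi) ?_
    refine (ae_restrict_iff' measurableSet_Ioi).2 (.of_forall fun y (hy : 1 < y) => ?_)
    have hy0 : 0 < y := by linarith
    rw [Real.norm_of_nonneg (by positivity),
      show (-(7:ℝ)/4) = -(3:ℝ)/4 + -1 by norm_num, Real.rpow_add hy0, Real.rpow_neg_one]
    gcongr
    linarith

theorem rpow_neg_three_quarters_le {x y : ℝ} (hx : 0 < x) (hxy : x ≤ y) :
    y ^ (-(3:ℝ)/4) ≤ x ^ (-(3:ℝ)/4) :=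
  Real.rpow_le_rpow_of_nonpos hx hxy (by norm_num)

theorem rpow_neg_three_quarters_mul_le {b x y : ℝ} (hb : 0 < b) (hx : 0 < x) (h : b * x ≤ y) :
    y ^ (-(3:ℝ)/4) ≤ b ^ (-(3:ℝ)/4) * x ^ (-(3:ℝ)/4) := by
  rw [← Real.mul_rpow hb.le hx.le]
  exact rpow_neg_three_quarters_le (by positivity) h

theorem half_le_rpow_neg_three_quarters {x : ℝ} (hx : 0 < x) (hx2 : x ≤ 2) :
    1 / 2 ≤ x ^ (-(3:ℝ)/4) := by
  refine le_trans ?_ (rpow_neg_three_quarters_le hx hx2)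
  calc (1 / 2 : ℝ) = 2 ^ (-1 : ℝ) := by rw [Real.rpow_neg_one]; norm_num
    _ ≤ 2 ^ (-(3:ℝ)/4) := Real.rpow_le_rpow_of_exponent_le (by norm_num) (by norm_num)

theorem quarter_mul_le_rpow_neg_three_quarters {s x : ℝ} (hs : 0 < s) (hx : 0 < x)
    (hxs : x ≤ 4 * s) : 1 / 4 * s ^ (-(3:ℝ)/4) ≤ x ^ (-(3:ℝ)/4) := by
  refine le_trans ?_ (rpow_neg_three_quarters_le hx hxs)
  rw [Real.mul_rpow (by norm_num) hs.le]
  gcongr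
  calc (1 / 4 : ℝ) = 4 ^ (-1 : ℝ) := by rw [Real.rpow_neg_one]; norm_num
    _ ≤ 4 ^ (-(3:ℝ)/4) := Real.rpow_le_rpow_of_exponent_le (by norm_num) (by norm_num)

theorem one_le_rpow_neg_three_quarters {x : ℝ} (hx : 0 < x) (hx1 : x ≤ 1) :
    1 ≤ x ^ (-(3:ℝ)/4) :=
  Real.one_le_rpow_of_pos_of_le_one_of_nonpos hx hx1 (by norm_num)

theorem four_mul_rpow_half {s : ℝ} (hs : 0 ≤ s) :
    (4 * s) ^ ((1:ℝ)/2) = 2 * s ^ ((1:ℝ)/2) := by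
  rw [Real.mul_rpow (by norm_num) hs, show (4:ℝ) = 2 ^ (2:ℝ) by norm_num,
    ← Real.rpow_mul (by norm_num)]
  norm_num

theorem continuousOn_rpow_mul_rpow {u v w x : ℝ → ℝ} {S : Set ℝ} {p : ℝ} (hu : Continuous u)
    (hv : Continuous v) (hw : Continuous w) (hx : Continuous x) (hv0 : ∀ z ∈ S, v z ≠ 0)
    (hw0 : ∀ z ∈ S, w z ≠ 0) (hx0 : ∀ z ∈ S, x z ≠ 0) :
    ContinuousOn (fun z => u z ^ ((1:ℝ)/2) * v z ^ p * w z ^ p * x z ^ p) S :=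
  (((hu.continuousOn.rpow_const fun _ _ => Or.inr (by norm_num)).mul
    (hv.continuousOn.rpow_const fun z hz => Or.inl (hv0 z hz))).mul
    (hw.continuousOn.rpow_const fun z hz => Or.inl (hw0 z hz))).mul
    (hx.continuousOn.rpow_const fun z hz => Or.inl (hx0 z hz))

theorem A1_two_sided {b : ℝ} (hb : 0 < b) (hb1 : b < 1) : ∃ K, ∀ a < -1,
    1 / 32 * (-a) ^ ((1:ℝ)/2) ≤ A1 a b ∧ A1 a b ≤ K * (-a) ^ ((1:ℝ)/2) := by
  set G : ℝ → ℝ := fun z => b ^ (-(3:ℝ)/4) * ((-z) ^ (-(3:ℝ)/4) * (-z + 1)⁻¹) with hGdef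
  have hG : IntegrableOn G (Iio 0) := by
    refine Integrable.const_mul ?_ _
    exact IntegrableOn.comp_neg_Iio (c := 0)
      (f := fun y : ℝ => y ^ (-(3:ℝ)/4) * (y + 1)⁻¹)
      (by simpa using integrableOn_rpow_mul_add_one_inv)
  refine ⟨∫ z in Iio 0, G z, fun a ha => ?_⟩
  have key := setIntegral_two_sided
    (f := fun z => (z - a) ^ ((1:ℝ)/2) * (-z) ^ (-(3:ℝ)/4) * (b - z) ^ (-(3:ℝ)/4)
      * (1 - z) ^ (-(3:ℝ)/4)) (G := G) (S := Ioo a 0) (U := Iio 0)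
    (c := 1 / 16 * (-a) ^ ((1:ℝ)/2)) (k := (-a) ^ ((1:ℝ)/2)) (p := -1 / 2) (q := 0)
    (by norm_num) (Ioo_subset_Ioo_left (by linarith)) Ioo_subset_Iio_self measurableSet_Ioo
    measurableSet_Iio
    (continuousOn_rpow_mul_rpow (by fun_prop) (by fun_prop) (by fun_prop) (by fun_prop)
      (fun z hz => ne_of_gt (by linarith [hz.2])) (fun z hz => ne_of_gt (by linarith [hz.2]))
      (fun z hz => ne_of_gt (by linarith [hz.2])))
    (fun z hz => ?_) (fun z (hz : z < 0) => ?_) hG (Real.rpow_nonneg (by linarith) _)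
    (fun z hz => ?_) (fun z hz => ?_)
  · rw [A1]
    constructor
    · linarith [key.1]
    · linarith [key.2]
  · obtain ⟨h1, h2⟩ := hz
    have hza : 0 < z - a := by linarith
    have hz0 : 0 < -z := by linarith
    have hzb : 0 < b - z := by linarith
    have hz1 : 0 < 1 - z := by linarith
    positivity
  · have : 0 < -z := by linarith
    rw [hGdef]
    positivity
  · obtain ⟨h1, h2⟩ := hz
    have hza : 0 < z - a := by linarith
    have hz0 : 0 < -z := by linarith
    have hzb : 0 < b - z := by linarith
    have e1 : 1 / 2 * (-a) ^ ((1:ℝ)/2) ≤ (z - a) ^ ((1:ℝ)/2) := by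
      have : (-a) ^ ((1:ℝ)/2) ≤ (4 * (z - a)) ^ ((1:ℝ)/2) :=
        Real.rpow_le_rpow (by linarith) (by linarith) (by norm_num)
      rw [four_mul_rpow_half (by linarith)] at this
      linarith
    have e2 := half_le_rpow_neg_three_quarters hz0 (by linarith)
    have e3 := half_le_rpow_neg_three_quarters hzb (by linarith)
    have e4 := half_le_rpow_neg_three_quarters (x := 1 - z) (by linarith) (by linarith)
    have : 0 ≤ (-a) ^ ((1:ℝ)/2) := Real.rpow_nonneg (by linarith) _
    calc 1 / 16 * (-a) ^ ((1:ℝ)/2) = 1 / 2 * (-a) ^ ((1:ℝ)/2) * (1 / 2) * (1 / 2) * (1 / 2) := by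
          ring
      _ ≤ _ := by gcongr
  · obtain ⟨h1, h2⟩ := hz
    have hz0 : 0 < -z := by linarith
    have hzb : 0 < b - z := by linarith
    have hz1 : 0 < 1 - z := by linarith
    have e1 : (z - a) ^ ((1:ℝ)/2) ≤ (-a) ^ ((1:ℝ)/2) :=
      Real.rpow_le_rpow (by linarith) (by linarith) (by norm_num)
    have e3 : (b - z) ^ (-(3:ℝ)/4) ≤ b ^ (-(3:ℝ)/4) * (1 - z) ^ (-(3:ℝ)/4) :=
      rpow_neg_three_quarters_mul_le hb hz1 (by nlinarith)
    have e4 : (1 - z) ^ (-(3:ℝ)/4) * (1 - z) ^ (-(3:ℝ)/4) ≤ (-z + 1)⁻¹ := by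
      rw [← Real.rpow_add hz1, ← Real.rpow_neg_one, neg_add_eq_sub]
      exact Real.rpow_le_rpow_of_exponent_le (by linarith) (by norm_num)
    have : 0 ≤ (-a) ^ ((1:ℝ)/2) := Real.rpow_nonneg (by linarith) _
    calc (z - a) ^ ((1:ℝ)/2) * (-z) ^ (-(3:ℝ)/4) * (b - z) ^ (-(3:ℝ)/4) * (1 - z) ^ (-(3:ℝ)/4)
        ≤ (-a) ^ ((1:ℝ)/2) * (-z) ^ (-(3:ℝ)/4) * (b ^ (-(3:ℝ)/4) * (1 - z) ^ (-(3:ℝ)/4))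
          * (1 - z) ^ (-(3:ℝ)/4) := by gcongr
      _ = (-a) ^ ((1:ℝ)/2) * (b ^ (-(3:ℝ)/4) * ((-z) ^ (-(3:ℝ)/4) *
          ((1 - z) ^ (-(3:ℝ)/4) * (1 - z) ^ (-(3:ℝ)/4)))) := by ring
      _ ≤ _ := by simp only [hGdef]; gcongr

theorem C1_two_sided {b : ℝ} (hb : 0 < b) (hb1 : b < 1) : ∃ K, ∀ a < -1,
    (1 - b) * (-a) ^ ((1:ℝ)/2) ≤ C1 a b ∧ C1 a b ≤ K * (-a) ^ ((1:ℝ)/2) := by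
  set m := (1 - b) / 2 with hm
  have hm0 : 0 < m := by rw [hm]; linarith
  set G : ℝ → ℝ := fun z => 2 * b ^ (-(3:ℝ)/4) * m ^ (-(3:ℝ)/4) *
    ((z - b) ^ (-(3:ℝ)/4) + (1 - z) ^ (-(3:ℝ)/4)) with hGdef
  have hG : IntegrableOn G (Ioo b 1) := by
    have h0 : IntervalIntegrable (fun y : ℝ => y ^ (-(3:ℝ)/4)) volume 0 (1 - b) :=
      intervalIntegral.intervalIntegrable_rpow' (by norm_num)
    have h1 := h0.comp_sub_right b
    have h2 := (h0.comp_sub_left 1).symm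
    rw [zero_add, sub_add_cancel] at h1
    rw [sub_zero, sub_sub_cancel] at h2
    exact ((intervalIntegrable_iff_integrableOn_Ioo_of_le hb1.le).1 (h1.add h2)).const_mul _
  refine ⟨∫ z in Ioo b 1, G z, fun a ha => ?_⟩
  have key := setIntegral_two_sided
    (f := fun z => (z - a) ^ ((1:ℝ)/2) * z ^ (-(3:ℝ)/4) * (z - b) ^ (-(3:ℝ)/4)
      * (1 - z) ^ (-(3:ℝ)/4)) (G := G) (S := Ioo b 1) (U := Ioo b 1)
    (c := (-a) ^ ((1:ℝ)/2)) (k := (-a) ^ ((1:ℝ)/2)) (p := b) (q := 1)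
    hb1.le subset_rfl subset_rfl measurableSet_Ioo measurableSet_Ioo
    (continuousOn_rpow_mul_rpow (by fun_prop) (by fun_prop) (by fun_prop) (by fun_prop)
      (fun z hz => ne_of_gt (by linarith [hz.1])) (fun z hz => ne_of_gt (by linarith [hz.1]))
      (fun z hz => ne_of_gt (by linarith [hz.2])))
    (fun z hz => ?_) (fun z hz => ?_) hG (Real.rpow_nonneg (by linarith) _)
    (fun z hz => ?_) (fun z hz => ?_)
  · rw [C1]
    constructor
    · linarith [key.1]
    · linarith [key.2]
  all_goals
    obtain ⟨h1, h2⟩ := hz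
    have hza : 0 < z - a := by linarith
    have hz0 : 0 < z := by linarith
    have hzb : 0 < z - b := by linarith
    have hz1 : 0 < 1 - z := by linarith
    have ha0 : 0 ≤ (-a) ^ ((1:ℝ)/2) := Real.rpow_nonneg (by linarith) _
  · positivity
  · rw [hGdef]
    positivity
  · have e1 : (-a) ^ ((1:ℝ)/2) ≤ (z - a) ^ ((1:ℝ)/2) :=
      Real.rpow_le_rpow (by linarith) (by linarith) (by norm_num)
    have e2 := one_le_rpow_neg_three_quarters hz0 h2.le
    have e3 := one_le_rpow_neg_three_quarters hzb (by linarith)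
    have e4 := one_le_rpow_neg_three_quarters hz1 (by linarith)
    calc (-a) ^ ((1:ℝ)/2) = (-a) ^ ((1:ℝ)/2) * 1 * 1 * 1 := by ring
      _ ≤ _ := by gcongr
  · have e1 : (z - a) ^ ((1:ℝ)/2) ≤ 2 * (-a) ^ ((1:ℝ)/2) := by
      rw [← four_mul_rpow_half (by linarith)]
      exact Real.rpow_le_rpow (by linarith) (by linarith) (by norm_num)
    have e2 := rpow_neg_three_quarters_le hb h1.le
    have e3 : (z - b) ^ (-(3:ℝ)/4) * (1 - z) ^ (-(3:ℝ)/4) ≤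
        m ^ (-(3:ℝ)/4) * ((z - b) ^ (-(3:ℝ)/4) + (1 - z) ^ (-(3:ℝ)/4)) := by
      have : 0 ≤ m ^ (-(3:ℝ)/4) := by positivity
      have : 0 ≤ (z - b) ^ (-(3:ℝ)/4) := by positivity
      have : 0 ≤ (1 - z) ^ (-(3:ℝ)/4) := by positivity
      rcases le_total m (z - b) with h | h
      · have := rpow_neg_three_quarters_le hm0 h
        nlinarith
      · have := rpow_neg_three_quarters_le hm0 (show m ≤ 1 - z by linarith)
        nlinarith
    calc (z - a) ^ ((1:ℝ)/2) * z ^ (-(3:ℝ)/4) * (z - b) ^ (-(3:ℝ)/4) * (1 - z) ^ (-(3:ℝ)/4)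
        = (z - a) ^ ((1:ℝ)/2) * z ^ (-(3:ℝ)/4) *
          ((z - b) ^ (-(3:ℝ)/4) * (1 - z) ^ (-(3:ℝ)/4)) := by ring
      _ ≤ 2 * (-a) ^ ((1:ℝ)/2) * b ^ (-(3:ℝ)/4) *
          (m ^ (-(3:ℝ)/4) * ((z - b) ^ (-(3:ℝ)/4) + (1 - z) ^ (-(3:ℝ)/4))) := by gcongr
      _ = _ := by rw [hGdef]; ring

theorem D1_two_sided {b : ℝ} (hb : 0 < b) (hb1 : b < 1) : ∃ K, ∀ a < -1,
    1 / √2 * (1 / 8) * (-a) ^ ((1:ℝ)/2) ≤ D1 a b ∧ D1 a b ≤ K * (-a) ^ ((1:ℝ)/2) := by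
  set G : ℝ → ℝ := fun z => 2 * (1 - b) ^ (-(3:ℝ)/4) *
    ((z - 1) ^ (-(3:ℝ)/4) * (z - 1 + 1)⁻¹) with hGdef
  have hG : IntegrableOn G (Ioi 1) := by
    refine Integrable.const_mul ?_ _
    have h := ((measurePreserving_sub_right volume (1:ℝ)).integrableOn_comp_preimage
      (MeasurableEquiv.subRight (1:ℝ)).measurableEmbedding).2 integrableOn_rpow_mul_add_one_inv
    simpa [Function.comp_def, IntegrableOn] using h
  refine ⟨1 / √2 * ∫ z in Ioi 1, G z, fun a ha => ?_⟩
  have hb' : 0 < 1 - b := by linarith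
  have key := setIntegral_two_sided
    (f := fun z => (z - a) ^ ((1:ℝ)/2) * z ^ (-(3:ℝ)/4) * (z - b) ^ (-(3:ℝ)/4)
      * (z - 1) ^ (-(3:ℝ)/4)) (G := G) (S := Ioi 1) (U := Ioi 1)
    (c := 1 / 8 * (-a) ^ ((1:ℝ)/2)) (k := (-a) ^ ((1:ℝ)/2)) (p := 1) (q := 2)
    (by norm_num) Ioo_subset_Ioi_self subset_rfl measurableSet_Ioi measurableSet_Ioi
    (continuousOn_rpow_mul_rpow (by fun_prop) (by fun_prop) (by fun_prop) (by fun_prop)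
      (fun z (hz : 1 < z) => ne_of_gt (by linarith))
      (fun z (hz : 1 < z) => ne_of_gt (by linarith))
      (fun z (hz : 1 < z) => ne_of_gt (by linarith)))
    (fun z (h1 : 1 < z) => ?_) (fun z (h1 : 1 < z) => ?_) hG (Real.rpow_nonneg (by linarith) _)
    (fun z ⟨h1, h2⟩ => ?_) (fun z (h1 : 1 < z) => ?_)
  · have h0 : 0 ≤ 1 / √2 := by positivity
    rw [D1]
    constructor
    · linarith [mul_le_mul_of_nonneg_left key.1 h0]
    · linarith [mul_le_mul_of_nonneg_left key.2 h0]
  all_goals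
    have hza : 0 < z - a := by linarith
    have hz0 : 0 < z := by linarith
    have hzb : 0 < z - b := by linarith
    have hz1 : 0 < z - 1 := by linarith
    have ha0 : 0 ≤ (-a) ^ ((1:ℝ)/2) := Real.rpow_nonneg (by linarith) _
  · positivity
  · simp only [hGdef, sub_add_cancel]
    positivity
  · have e1 : (-a) ^ ((1:ℝ)/2) ≤ (z - a) ^ ((1:ℝ)/2) :=
      Real.rpow_le_rpow (by linarith) (by linarith) (by norm_num)
    have e2 := half_le_rpow_neg_three_quarters hz0 h2.le
    have e3 := half_le_rpow_neg_three_quarters hzb (by linarith)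
    have e4 := half_le_rpow_neg_three_quarters hz1 (by linarith)
    calc 1 / 8 * (-a) ^ ((1:ℝ)/2) = (-a) ^ ((1:ℝ)/2) * (1 / 2) * (1 / 2) * (1 / 2) := by ring
      _ ≤ _ := by gcongr
  · have e1 : (z - a) ^ ((1:ℝ)/2) ≤ 2 * ((-a) ^ ((1:ℝ)/2) * z ^ ((1:ℝ)/2)) := by
      rw [← Real.mul_rpow (by linarith) hz0.le, ← four_mul_rpow_half (by nlinarith)]
      exact Real.rpow_le_rpow hza.le (by nlinarith) (by norm_num)
    have e3 : (z - b) ^ (-(3:ℝ)/4) ≤ (1 - b) ^ (-(3:ℝ)/4) * z ^ (-(3:ℝ)/4) :=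
      rpow_neg_three_quarters_mul_le hb' hz0 (by nlinarith)
    have e4 : z ^ ((1:ℝ)/2) * z ^ (-(3:ℝ)/4) * z ^ (-(3:ℝ)/4) = (z - 1 + 1)⁻¹ := by
      rw [← Real.rpow_add hz0, ← Real.rpow_add hz0, sub_add_cancel, ← Real.rpow_neg_one]
      norm_num
    calc (z - a) ^ ((1:ℝ)/2) * z ^ (-(3:ℝ)/4) * (z - b) ^ (-(3:ℝ)/4) * (z - 1) ^ (-(3:ℝ)/4)
        ≤ 2 * ((-a) ^ ((1:ℝ)/2) * z ^ ((1:ℝ)/2)) * z ^ (-(3:ℝ)/4) *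
          ((1 - b) ^ (-(3:ℝ)/4) * z ^ (-(3:ℝ)/4)) * (z - 1) ^ (-(3:ℝ)/4) := by gcongr
      _ = _ := by rw [hGdef]; simp only [← e4]; ring

theorem B1_two_sided {b : ℝ} (hb : 0 < b) (hb1 : b < 1) : ∀ a < -1,
    1 / 64 * (-a) ^ (-(3:ℝ)/4) ≤ B1 a b ∧ B1 a b ≤ 4 / 3 * (-a) ^ (-(3:ℝ)/4) := by
  intro a ha
  have hs : 0 < -a := by linarith
  have hG : IntegrableOn (fun z : ℝ => (-z) ^ (-(7:ℝ)/4)) (Iio a) :=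
    IntegrableOn.comp_neg_Iio (c := a) (f := fun y : ℝ => y ^ (-(7:ℝ)/4))
      (integrableOn_Ioi_rpow_of_lt (by norm_num) hs)
  have hGint : ∫ z in Iio a, (-z) ^ (-(7:ℝ)/4) = 4 / 3 * (-a) ^ (-(3:ℝ)/4) := by
    rw [← integral_Iic_eq_integral_Iio,
      integral_comp_neg_Iic a (fun y : ℝ => y ^ (-(7:ℝ)/4)),
      integral_Ioi_rpow_of_lt (by norm_num) hs]
    norm_num
    ring
  have hpow : (-a) ^ ((1:ℝ)/2) * (-a) ^ (-(3:ℝ)/4) * (-a) ^ (-(3:ℝ)/4) * (-a) ^ (-(3:ℝ)/4) * -a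
      = (-a) ^ (-(3:ℝ)/4) := by
    simp only [← Real.rpow_add hs]
    rw [← Real.rpow_add_one hs.ne']
    norm_num
  have key := setIntegral_two_sided
    (f := fun z => (a - z) ^ ((1:ℝ)/2) * (-z) ^ (-(3:ℝ)/4) * (b - z) ^ (-(3:ℝ)/4)
      * (1 - z) ^ (-(3:ℝ)/4)) (G := fun z => (-z) ^ (-(7:ℝ)/4)) (S := Iio a) (U := Iio a)
    (c := (-a) ^ ((1:ℝ)/2) * (1 / 4 * (-a) ^ (-(3:ℝ)/4)) * (1 / 4 * (-a) ^ (-(3:ℝ)/4)) *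
      (1 / 4 * (-a) ^ (-(3:ℝ)/4))) (k := 1) (p := 3 * a) (q := 2 * a)
    (by linarith) (Ioo_subset_Iio_self.trans (Iio_subset_Iio (by linarith))) subset_rfl
    measurableSet_Iio measurableSet_Iio
    (continuousOn_rpow_mul_rpow (by fun_prop) (by fun_prop) (by fun_prop) (by fun_prop)
      (fun z (hz : z < a) => ne_of_gt (by linarith))
      (fun z (hz : z < a) => ne_of_gt (by linarith))
      (fun z (hz : z < a) => ne_of_gt (by linarith)))
    (fun z (h1 : z < a) => ?_) (fun z (h1 : z < a) => ?_) hG zero_le_one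
    (fun z ⟨h2, h1'⟩ => ?_) (fun z (h1 : z < a) => ?_)
  · rw [B1]
    rw [hGint] at key
    constructor
    · linarith [key.1]
    · linarith [key.2]
  on_goal 3 => have h1 : z < a := by linarith
  all_goals
    have hza : 0 < a - z := by linarith
    have hz0 : 0 < -z := by linarith
    have hzb : 0 < b - z := by linarith
    have hz1 : 0 < 1 - z := by linarith
  · positivity
  · positivity
  · have e1 : (-a) ^ ((1:ℝ)/2) ≤ (a - z) ^ ((1:ℝ)/2) :=
      Real.rpow_le_rpow hs.le (by linarith) (by norm_num)
    have e2 := quarter_mul_le_rpow_neg_three_quarters hs hz0 (by linarith)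
    have e3 := quarter_mul_le_rpow_neg_three_quarters hs hzb (by linarith)
    have e4 := quarter_mul_le_rpow_neg_three_quarters hs hz1 (by linarith)
    gcongr
  · have e1 : (a - z) ^ ((1:ℝ)/2) ≤ (-z) ^ ((1:ℝ)/2) :=
      Real.rpow_le_rpow hza.le (by linarith) (by norm_num)
    have e3 := rpow_neg_three_quarters_le hz0 (show -z ≤ b - z by linarith)
    have e4 := rpow_neg_three_quarters_le hz0 (show -z ≤ 1 - z by linarith)
    calc (a - z) ^ ((1:ℝ)/2) * (-z) ^ (-(3:ℝ)/4) * (b - z) ^ (-(3:ℝ)/4) * (1 - z) ^ (-(3:ℝ)/4)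
        ≤ (-z) ^ ((1:ℝ)/2) * (-z) ^ (-(3:ℝ)/4) * (-z) ^ (-(3:ℝ)/4) * (-z) ^ (-(3:ℝ)/4) := by
          gcongr
      _ = 1 * (-z) ^ (-(7:ℝ)/4) := by
          simp only [← Real.rpow_add hz0]
          norm_num

theorem cs4_phi1_asymptotics_a_to_neg_infty :
    ∀ b : ℝ, 0 < b → b < 1 → ∃ C M : ℝ, 0 < C ∧ 0 < M ∧
      ∀ a : ℝ, a < -M →
        ((1 / C) * (-a) ^ ((1:ℝ)/2) ≤ A1 a b ∧ A1 a b ≤ C * (-a) ^ ((1:ℝ)/2)) ∧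
        ((1 / C) * (-a) ^ ((1:ℝ)/2) ≤ C1 a b ∧ C1 a b ≤ C * (-a) ^ ((1:ℝ)/2)) ∧
        ((1 / C) * (-a) ^ ((1:ℝ)/2) ≤ D1 a b ∧ D1 a b ≤ C * (-a) ^ ((1:ℝ)/2)) ∧
        ((1 / C) * (-a) ^ (-(3:ℝ)/4) ≤ B1 a b ∧ B1 a b ≤ C * (-a) ^ (-(3:ℝ)/4)) := by
  intro b hb hb1
  have hh : ∀ p : ℝ, ∀ a < (-1 : ℝ), 0 ≤ (-a) ^ p := fun p a ha =>
    Real.rpow_nonneg (by linarith) p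
  obtain ⟨KA, hA⟩ := A1_two_sided hb hb1
  obtain ⟨KC, hC⟩ := C1_two_sided hb hb1
  obtain ⟨KD, hD⟩ := D1_two_sided hb hb1
  obtain ⟨A, hA⟩ := exists_forall_ge_two_sided (by norm_num) (hh _) hA
  obtain ⟨C, hC⟩ := exists_forall_ge_two_sided (by linarith) (hh _) hC
  obtain ⟨D, hD⟩ := exists_forall_ge_two_sided (by positivity) (hh _) hD
  obtain ⟨B, hB⟩ := exists_forall_ge_two_sided (by norm_num) (hh _) (B1_two_sided hb hb1)
  obtain ⟨E, hE⟩ := ({1, A, C, D, B} : Finset ℝ).bddAbove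
  have hle : ∀ x ∈ ({1, A, C, D, B} : Finset ℝ), x ≤ E := fun x hx => hE hx
  exact ⟨E, 1, zero_lt_one.trans_le (hle 1 (by simp)), one_pos, fun a ha =>
    ⟨hA E (hle A (by simp)) a ha, hC E (hle C (by simp)) a ha, hD E (hle D (by simp)) a ha,
      hB E (hle B (by simp)) a ha⟩⟩
end
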